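/- There exists an absolute constant C > 0 with the following property. Let n, d ≥ 1 and let r, s : ℤ → ℝ be even functions with r(0) = s(0) = 1, |r(k)| ≤ 1 for all k, Σ_{k∈ℤ} s(k)² < ∞, and Σ_{k∈ℤ} |r(k)| < ∞. Let (X_{ik})_{1≤i≤n, 1≤k≤d} be jointly Gaussian centered random variables with E[X_{ik} X_{jl}] = r(i−j) s(k−l), and set W̃_{ij} = d^{-1/2} Σ_{k=1}^d ( X_{ik} X_{jk} − r(i−j) ). Let (G_{ij})_{1≤i≤j≤n} be jointly Gaussian centered random variables with E[G_{ij} G_{uv}] = ( r(i−u) r(v−j) + r(i−v) r(u−j) ) · d^{-1} Σ_{k,l=1}^d s(k−l)². Then for every twice continuously differentiable g : ℝ^{n(n+1)/2} → ℝ all of whose second partial derivatives are bounded in absolute value by 1, |E[g((W̃_{ij})_{i≤j})] − E[g((G_{ij})_{i≤j})]| ≤ C · ( Σ_{k∈ℤ} |r(k)| ) · n³ · d^{-1/2} · ( Σ_{|k|≤d} |s(k)|^{4/3} )^{3/2}. -/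

import Mathlib

open MeasureTheory ProbabilityTheory

/-- A family of real random variables is jointly Gaussian and centered if every finite
linear combination of its members has a centered Gaussian law. -/
def IsCenteredGaussianFamily {Ω : Type*} [MeasureSpace Ω] {ι : Type*} (X : ι → Ω → ℝ) : Prop :=
  ∀ (S : Finset ι) (c : ι → ℝ), ∃ v : NNReal,
    Measure.map (fun ω => ∑ i ∈ S, c i * X i ω) volume = gaussianReal 0 v

lemma hasDerivAt_gaussianPDFReal_zero {v : NNReal} (hv : v ≠ 0) (t : ℝ) :
    HasDerivAt (gaussianPDFReal 0 v) (-(t / v) * gaussianPDFReal 0 v t) t := by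
  have hv' : (v : ℝ) ≠ 0 := by exact_mod_cast hv
  have h1 : HasDerivAt (fun x : ℝ => -(x - 0) ^ 2 / (2 * v)) (-(t / v)) t := by
    have := (((hasDerivAt_id t).sub_const 0).pow 2).neg.div_const (2 * (v : ℝ))
    refine this.congr_deriv ?_
    simp; field_simp
  have := (h1.exp).const_mul (√(2 * Real.pi * v))⁻¹
  refine this.congr_deriv ?_
  rw [gaussianPDFReal]; ring

lemma integrable_gaussianReal_iff {v : NNReal} (hv : v ≠ 0) (f : ℝ → ℝ) :
    Integrable f (gaussianReal 0 v) ↔ Integrable (fun t => gaussianPDFReal 0 v t * f t) := by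
  rw [gaussianReal_of_var_ne_zero 0 hv, integrable_withDensity_iff_integrable_smul'
    (measurable_gaussianPDF 0 v) (ae_of_all _ fun x => gaussianPDF_lt_top)]
  simp [toReal_gaussianPDF]

/-- Gaussian integration by parts on the real line. -/
lemma integral_id_mul_gaussianReal {v : NNReal} {f f' : ℝ → ℝ}
    (hf : ∀ t, HasDerivAt f (f' t) t)
    (h1 : Integrable f (gaussianReal 0 v)) (h2 : Integrable f' (gaussianReal 0 v))
    (h3 : Integrable (fun t => t * f t) (gaussianReal 0 v)) :
    ∫ t, t * f t ∂(gaussianReal 0 v) = v * ∫ t, f' t ∂(gaussianReal 0 v) := by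
  by_cases hv : v = 0
  · subst hv; simp
  have hv' : (v : ℝ) ≠ 0 := by exact_mod_cast hv
  rw [integrable_gaussianReal_iff hv] at h1 h2 h3
  rw [integral_gaussianReal_eq_integral_smul hv, integral_gaussianReal_eq_integral_smul hv]
  have key := integral_mul_deriv_eq_deriv_mul_of_integrable (u := f) (u' := f')
    (v := gaussianPDFReal 0 v) (v' := fun t => -(t / v) * gaussianPDFReal 0 v t)
    (fun t _ => hf t) (fun t _ => hasDerivAt_gaussianPDFReal_zero hv t) ?_ ?_ ?_
  · simp only [smul_eq_mul]
    have e1 : ∫ t, gaussianPDFReal 0 v t * (t * f t)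
        = -v * ∫ t, f t * (-(t / v) * gaussianPDFReal 0 v t) := by
      rw [← integral_const_mul]; congr 1; funext t; field_simp
    rw [e1, key]
    simp only [mul_comm (f' _)]; ring
  · convert h3.const_mul (-(1 / (v : ℝ))) using 2 with t
    simp; ring
  · convert h2 using 2 with t; simp [mul_comm]
  · convert h1 using 2 with t; simp [mul_comm]

/-- Gaussian integration by parts: if `v` represents the covariance with `L`, integrating against
`L` amounts to differentiating in the direction `v`. -/
lemma integral_dual_mul_of_isGaussian {E : Type*} [NormedAddCommGroup E] [NormedSpace ℝ E]
    [MeasurableSpace E] [BorelSpace E] [CompleteSpace E] [SecondCountableTopology E]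
    (μ : Measure E) [IsGaussian μ] (L : StrongDual ℝ E) (v : E)
    (hL0 : ∫ x, L x ∂μ = 0) (hv : ∀ M : StrongDual ℝ E, M v = ∫ x, L x * M x ∂μ)
    {F D : E → ℝ} (hF : ∀ x, HasDerivAt (fun t : ℝ => F (x + t • v)) (D x) 0)
    (cF : Continuous F) (cD : Continuous D)
    (iF : Integrable F μ) (iD : Integrable D μ) (iLF : Integrable (fun x => L x * F x) μ) :
    ∫ x, L x * F x ∂μ = ∫ x, D x ∂μ := by
  have mL : ∀ M : StrongDual ℝ E, MemLp M 2 μ := fun M => IsGaussian.memLp_dual μ M 2 (by simp)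
  have hvar : Var[L; μ] = L v := by
    rw [variance_eq_integral L.continuous.aemeasurable, hL0, hv L]
    simp [pow_two]
  by_cases h0 : L v = 0
  · have hLz : (fun x => L x) =ᵐ[μ] 0 := by
      have : ∫ x, L x * L x ∂μ = 0 := by rw [← hv L, h0]
      rw [integral_eq_zero_iff_of_nonneg (fun x => mul_self_nonneg _)
        ((mL L).integrable_mul (mL L))] at this
      filter_upwards [this] with x hx
      simpa using hx
    have hv0 : v = 0 := by
      refine (SeparatingDual.eq_zero_iff_forall_dual_eq_zero (R := ℝ) v).2 fun M => ?_
      rw [hv M]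
      refine integral_eq_zero_of_ae ?_
      filter_upwards [hLz] with x hx
      simp [hx]
    have hD : ∀ x, D x = 0 := fun x => by
      have := hF x
      simp only [hv0, smul_zero, add_zero] at this
      exact this.unique (hasDerivAt_const _ _)
    simp only [hD, integral_zero]
    refine integral_eq_zero_of_ae ?_
    filter_upwards [hLz] with x hx
    simp [hx]
  have hpos : 0 ≤ L v := hvar ▸ variance_nonneg _ _
  set w : E := (L v)⁻¹ • v with hw
  set R : E →L[ℝ] E := ContinuousLinearMap.id ℝ E - L.smulRight w with hR
  have hRx : ∀ x, R x = x - L x • w := fun x => by simp [hR]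
  have hlaw : HasGaussianLaw (fun x => (L x, R x)) μ :=
    (IsGaussian.hasGaussianLaw_id (μ := μ)).map_fun (L.prod R)
  have hind : IndepFun L R μ := by
    refine hlaw.indepFun_of_covariance_strongDual fun L₁ M => ?_
    have e1 : L₁ ∘ L = fun x => L₁ 1 * L x := by
      ext x
      have := L₁.map_smul (L x) 1
      simp only [smul_eq_mul, mul_one] at this
      simp [this, mul_comm]
    rw [e1, covariance_const_mul_left,
      covariance_eq_sub (mL L) (show MemLp (M ∘ R) 2 μ from mL (M ∘L R)), hL0]
    have e2 : ∫ x, (L * (M ∘ R)) x ∂μ = 0 := by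
      have := hv (M ∘L R)
      simp only [ContinuousLinearMap.coe_comp, Function.comp_apply] at this
      simp only [Pi.mul_apply, Function.comp_apply]
      rw [← this, hRx, hw, smul_smul, mul_inv_cancel₀ h0]
      simp
    simp only [e2]
    simp
  have hmap := (indepFun_iff_map_prod_eq_prod_map_map L.continuous.aemeasurable
    R.continuous.aemeasurable).1 hind
  have hmapL : μ.map L = gaussianReal 0 (L v).toNNReal := by
    rw [IsGaussian.map_eq_gaussianReal L, hL0, hvar]
  rw [hmapL] at hmap
  have hdec : ∀ x, L x • w + R x = x := fun x => by simp [hRx]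
  set ν := (gaussianReal 0 (L v).toNNReal).prod (μ.map R) with hν
  have mLR : AEMeasurable (fun x => (L x, R x)) μ := hlaw.aemeasurable
  have : IsProbabilityMeasure (μ.map R) :=
    Measure.isProbabilityMeasure_map R.continuous.aemeasurable
  have trans : ∀ h : ℝ × E → ℝ, Continuous h →
      ∫ x, h (L x, R x) ∂μ = ∫ z, h z ∂ν := fun h hc => by
    rw [← hmap, integral_map mLR hc.aestronglyMeasurable]
  have transI : ∀ h : ℝ × E → ℝ, Continuous h → Integrable (fun x => h (L x, R x)) μ →
      Integrable h ν := fun h hc hi => by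
    rw [← hmap]
    exact (integrable_map_measure hc.aestronglyMeasurable mLR).2 hi
  have c1 : Continuous fun z : ℝ × E => F (z.1 • w + z.2) := by fun_prop
  have c2 : Continuous fun z : ℝ × E => D (z.1 • w + z.2) := by fun_prop
  have c3 : Continuous fun z : ℝ × E => z.1 * F (z.1 • w + z.2) := by fun_prop
  have j1 := transI _ c1 (by simpa only [hdec] using iF)
  have j2 := transI _ c2 (by simpa only [hdec] using iD)
  have j3 := transI _ c3 (by simpa only [hdec] using iLF)
  have t2 := trans _ c2
  have t3 := trans _ c3
  simp only [hdec] at t2 t3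
  rw [t2, t3, integral_prod_symm _ j3, integral_prod_symm _ j2]
  refine integral_congr_ae ?_
  filter_upwards [j1.prod_left_ae, j2.prod_left_ae, j3.prod_left_ae] with ρ k1 k2 k3
  have hder : ∀ t : ℝ, HasDerivAt (fun t : ℝ => F (t • w + ρ))
      ((L v)⁻¹ * D (t • w + ρ)) t := fun t => by
    have a1 := hF (t • w + ρ)
    have a2 : HasDerivAt (fun s : ℝ => (L v)⁻¹ * (s - t)) ((L v)⁻¹) t := by
      simpa using ((hasDerivAt_id t).sub_const t).const_mul ((L v)⁻¹)
    have a3 := HasDerivAt.comp t (h := fun s : ℝ => (L v)⁻¹ * (s - t))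
      (h₂ := fun s : ℝ => F (t • w + ρ + s • v)) (by simpa using a1) a2
    rw [mul_comm]
    refine a3.congr_of_eventuallyEq (Filter.Eventually.of_forall fun s => ?_)
    simp only [Function.comp_apply]
    congr 1
    rw [hw]; module
  have := integral_id_mul_gaussianReal hder k1 (k2.const_mul _) k3
  rw [this, integral_const_mul, Real.coe_toNNReal _ hpos, mul_inv_cancel_left₀ h0]

/-- Continuous functions of at most polynomial growth. -/
def PolyGrowth {E : Type*} [NormedAddCommGroup E] (f : E → ℝ) : Prop :=
  Continuous f ∧ ∃ (C : ℝ) (k : ℕ), ∀ x, |f x| ≤ C * (1 + ‖x‖) ^ k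

namespace PolyGrowth

variable {E : Type*} [NormedAddCommGroup E] {f g : E → ℝ}

lemma exists_nonneg_bound (hf : PolyGrowth f) :
    ∃ (C : ℝ) (k : ℕ), 0 ≤ C ∧ ∀ x, |f x| ≤ C * (1 + ‖x‖) ^ k := by
  obtain ⟨-, C, k, h⟩ := hf
  refine ⟨C, k, ?_, h⟩
  have := h 0
  simp only [norm_zero, add_zero, one_pow, mul_one] at this
  exact (abs_nonneg _).trans this

lemma const (c : ℝ) : PolyGrowth (fun _ : E => c) :=
  ⟨continuous_const, |c|, 0, fun x => by simp⟩

lemma add (hf : PolyGrowth f) (hg : PolyGrowth g) : PolyGrowth (fun x => f x + g x) := by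
  obtain ⟨C, k, hC, h⟩ := hf.exists_nonneg_bound
  obtain ⟨C', k', hC', h'⟩ := hg.exists_nonneg_bound
  refine ⟨hf.1.add hg.1, C + C', k + k', fun x => ?_⟩
  have h1 : (1 : ℝ) ≤ 1 + ‖x‖ := by linarith [norm_nonneg x]
  have e1 : (1 + ‖x‖) ^ k ≤ (1 + ‖x‖) ^ (k + k') := pow_le_pow_right₀ h1 (by lia)
  have e2 : (1 + ‖x‖) ^ k' ≤ (1 + ‖x‖) ^ (k + k') := pow_le_pow_right₀ h1 (by lia)
  calc |f x + g x| ≤ |f x| + |g x| := abs_add_le _ _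
    _ ≤ C * (1 + ‖x‖) ^ k + C' * (1 + ‖x‖) ^ k' := add_le_add (h x) (h' x)
    _ ≤ C * (1 + ‖x‖) ^ (k + k') + C' * (1 + ‖x‖) ^ (k + k') := by gcongr
    _ = _ := by ring

lemma mul (hf : PolyGrowth f) (hg : PolyGrowth g) : PolyGrowth (fun x => f x * g x) := by
  obtain ⟨C, k, hC, h⟩ := hf.exists_nonneg_bound
  obtain ⟨C', k', hC', h'⟩ := hg.exists_nonneg_bound
  refine ⟨hf.1.mul hg.1, C * C', k + k', fun x => ?_⟩
  calc |f x * g x| = |f x| * |g x| := abs_mul _ _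
    _ ≤ (C * (1 + ‖x‖) ^ k) * (C' * (1 + ‖x‖) ^ k') :=
      mul_le_mul (h x) (h' x) (abs_nonneg _) (by positivity)
    _ = _ := by ring

lemma const_mul (hf : PolyGrowth f) (c : ℝ) : PolyGrowth (fun x => c * f x) := (const c).mul hf

lemma sub (hf : PolyGrowth f) (hg : PolyGrowth g) : PolyGrowth (fun x => f x - g x) := by
  have := hf.add (hg.const_mul (-1))
  simpa [sub_eq_add_neg] using this

lemma abs (hf : PolyGrowth f) : PolyGrowth (fun x => |f x|) := by
  obtain ⟨hc, C, k, h⟩ := hf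
  exact ⟨hc.abs, C, k, fun x => by simpa using h x⟩

lemma pow (hf : PolyGrowth f) (m : ℕ) : PolyGrowth (fun x => f x ^ m) := by
  induction m with
  | zero => simpa using const (E := E) 1
  | succ m ih => simpa [pow_succ] using ih.mul hf

lemma sum {ι : Type*} (s : Finset ι) {F : ι → E → ℝ} (h : ∀ i, PolyGrowth (F i)) :
    PolyGrowth (fun x => ∑ i ∈ s, F i x) := by
  classical
  induction s using Finset.induction_on with
  | empty => simpa using const (E := E) 0
  | insert a s ha ih => simpa [Finset.sum_insert ha] using (h a).add ih

lemma dual [NormedSpace ℝ E] (L : StrongDual ℝ E) : PolyGrowth (fun x => L x) :=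
  ⟨L.continuous, ‖L‖, 1, fun x => by
    have := L.le_opNorm x
    rw [Real.norm_eq_abs] at this
    rw [pow_one]
    nlinarith [norm_nonneg L, norm_nonneg x]⟩

lemma comp {P : Type*} [Fintype P] {h : (P → ℝ) → ℝ} (hh : PolyGrowth h) {u : P → E → ℝ}
    (hu : ∀ p, PolyGrowth (u p)) : PolyGrowth (fun x => h fun p => u p x) := by
  obtain ⟨C, k, hC, hb⟩ := hh.exists_nonneg_bound
  obtain ⟨-, C', k', hb'⟩ : PolyGrowth fun x => (1 + ∑ p, |u p x|) ^ k :=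
    ((const 1).add (sum _ fun p => (hu p).abs)).pow k
  refine ⟨hh.1.comp (continuous_pi fun p => (hu p).1), C * C', k', fun x => ?_⟩
  have h1 : ‖fun p => u p x‖ ≤ ∑ p, |u p x| :=
    (pi_norm_le_iff_of_nonneg (by positivity)).2 fun p =>
      Finset.single_le_sum (f := fun p => |u p x|) (fun i _ => abs_nonneg _) (Finset.mem_univ p)
  calc |h fun p => u p x| ≤ C * (1 + ‖fun p => u p x‖) ^ k := hb _
    _ ≤ C * (1 + ∑ p, |u p x|) ^ k := by gcongr
    _ ≤ C * (C' * (1 + ‖x‖) ^ k') := by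
      gcongr
      exact (le_abs_self _).trans (hb' x)
    _ = _ := by ring

lemma integrable [NormedSpace ℝ E] [MeasurableSpace E] [BorelSpace E] [CompleteSpace E]
    [SecondCountableTopology E] (hf : PolyGrowth f) (μ : Measure E) [IsGaussian μ] :
    Integrable f μ := by
  obtain ⟨C, k, hC, h⟩ := hf.exists_nonneg_bound
  have i0 : MemLp (fun x : E => ‖x‖) (k : ENNReal) μ :=
    (IsGaussian.memLp_id μ (k : ENNReal) (ENNReal.natCast_ne_top k)).norm
  have i1 : MemLp (fun x : E => 1 + ‖x‖) (k : ENNReal) μ := (memLp_const (1 : ℝ)).add i0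
  have i2 : Integrable (fun x : E => C * (1 + ‖x‖) ^ k) μ := by
    have i3 := i1.integrable_norm_pow'
    have e : ∀ x : E, ‖1 + ‖x‖‖ = 1 + ‖x‖ := fun x => Real.norm_of_nonneg (by positivity)
    simp only [e] at i3
    exact i3.const_mul C
  exact i2.mono' hf.1.aestronglyMeasurable (ae_of_all _ h)

/-- A differentiable function whose derivative has polynomial growth has polynomial growth. -/
lemma of_norm_fderiv_le [NormedSpace ℝ E] {C : ℝ} {k : ℕ} (hf : Differentiable ℝ f)
    (h : ∀ x, ‖fderiv ℝ f x‖ ≤ C * (1 + ‖x‖) ^ k) : PolyGrowth f := by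
  have hC : 0 ≤ C := by
    have := h 0
    simp only [norm_zero, add_zero, one_pow, mul_one] at this
    exact (norm_nonneg _).trans this
  have key : PolyGrowth fun x => f x - f 0 := by
    refine ⟨hf.continuous.sub continuous_const, C, k + 1, fun x => ?_⟩
    have hb : ∀ y ∈ Metric.closedBall (0 : E) ‖x‖, ‖fderiv ℝ f y‖ ≤ C * (1 + ‖x‖) ^ k := by
      intro y hy
      have hy' : ‖y‖ ≤ ‖x‖ := by simpa using hy
      exact (h y).trans (by gcongr)
    have h0 : (0 : E) ∈ Metric.closedBall (0 : E) ‖x‖ := by simp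
    have h1 : x ∈ Metric.closedBall (0 : E) ‖x‖ := by simp
    have := Convex.norm_image_sub_le_of_norm_fderiv_le (fun y _ => hf y) hb
      (convex_closedBall (0 : E) ‖x‖) h0 h1
    rw [sub_zero, Real.norm_eq_abs] at this
    refine this.trans ?_
    rw [pow_succ, ← mul_assoc]
    gcongr
    linarith
  have := key.add (const (f 0))
  simp only [sub_add_cancel] at this
  exact this

end PolyGrowth

/-- Interpolation between two random vectors `W` and `Y` along `sin θ • W + cos θ • Y`, when both
satisfy integration by parts formulas with kernels `T` and `σ` respectively. -/
lemma abs_integral_sub_integral_le_of_interpolation {E P : Type*} [Fintype P]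
    [NormedAddCommGroup E] [NormedSpace ℝ E] [MeasurableSpace E] [BorelSpace E] [CompleteSpace E]
    [SecondCountableTopology E] (μ : Measure E) [IsGaussian μ]
    {W Y : P → E → ℝ} {T : P → P → E → ℝ} {σ : P → P → ℝ}
    (hW : ∀ p, PolyGrowth (W p)) (hY : ∀ p, PolyGrowth (Y p)) (hT : ∀ p q, PolyGrowth (T p q))
    {g : (P → ℝ) → ℝ} {g1 : P → (P → ℝ) → ℝ} {g2 : P → P → (P → ℝ) → ℝ}
    (hg : ∀ x, HasFDerivAt g (∑ p, g1 p x • (ContinuousLinearMap.proj p : (P → ℝ) →L[ℝ] ℝ)) x)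
    (pg : PolyGrowth g) (pg1 : ∀ p, PolyGrowth (g1 p)) (pg2 : ∀ p q, PolyGrowth (g2 p q))
    (hg2 : ∀ p q x, |g2 p q x| ≤ 1)
    (h1 : ∀ (θ : ℝ) (p : P),
      ∫ z, W p z * g1 p (fun p => Real.sin θ * W p z + Real.cos θ * Y p z) ∂μ
        = Real.sin θ * ∑ q, ∫ z, g2 p q (fun p => Real.sin θ * W p z + Real.cos θ * Y p z)
            * T p q z ∂μ)
    (h2 : ∀ (θ : ℝ) (p : P),
      ∫ z, Y p z * g1 p (fun p => Real.sin θ * W p z + Real.cos θ * Y p z) ∂μ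
        = Real.cos θ * ∑ q, ∫ z, g2 p q (fun p => Real.sin θ * W p z + Real.cos θ * Y p z)
            * σ p q ∂μ) :
    |(∫ z, g (fun p => W p z) ∂μ) - ∫ z, g (fun p => Y p z) ∂μ|
      ≤ Real.pi / 2 * ∑ p, ∑ q, ∫ z, |T p q z - σ p q| ∂μ := by
  set u : ℝ → E → P → ℝ := fun θ z p => Real.sin θ * W p z + Real.cos θ * Y p z with hu
  have pu : ∀ θ p, PolyGrowth fun z => u θ z p := fun θ p =>
    ((hW p).const_mul _).add ((hY p).const_mul _)
  set φ : ℝ → ℝ := fun θ => ∫ z, g (u θ z) ∂μ with hφ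
  set d : ℝ → E → ℝ := fun θ z =>
    ∑ p, g1 p (u θ z) * (Real.cos θ * W p z - Real.sin θ * Y p z) with hd
  have hderiv : ∀ θ z, HasDerivAt (fun θ => g (u θ z)) (d θ z) θ := fun θ z => by
    have hu' : HasDerivAt (fun θ => u θ z)
        (fun p => Real.cos θ * W p z - Real.sin θ * Y p z) θ := by
      refine hasDerivAt_pi.2 fun p => ?_
      have := ((Real.hasDerivAt_sin θ).mul_const (W p z)).add
        ((Real.hasDerivAt_cos θ).mul_const (Y p z))
      refine this.congr_deriv ?_
      ring
    have := (hg (u θ z)).comp_hasDerivAt θ hu'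
    refine this.congr_deriv ?_
    simp [hd]
  have pd : ∀ θ, PolyGrowth (d θ) := fun θ => PolyGrowth.sum _ fun p =>
    ((pg1 p).comp (pu θ)).mul (((hW p).const_mul _).sub ((hY p).const_mul _))
  choose C k hC hb using fun p => (pg1 p).exists_nonneg_bound
  have pB : PolyGrowth fun z => 1 + ∑ q, (|W q z| + |Y q z|) :=
    (PolyGrowth.const 1).add (PolyGrowth.sum _ fun q => (hW q).abs.add (hY q).abs)
  have pbound : PolyGrowth fun z => ∑ p, C p * (1 + ∑ q, (|W q z| + |Y q z|)) ^ k p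
      * (|W p z| + |Y p z|) :=
    PolyGrowth.sum _ fun p => ((pB.pow (k p)).const_mul (C p)).mul ((hW p).abs.add (hY p).abs)
  have tri : ∀ a b x y : ℝ, |a| ≤ 1 → |b| ≤ 1 → |a * x + b * y| ≤ |x| + |y| := by
    intro a b x y ha hb
    calc |a * x + b * y| ≤ |a * x| + |b * y| := abs_add_le _ _
      _ = |a| * |x| + |b| * |y| := by rw [abs_mul, abs_mul]
      _ ≤ 1 * |x| + 1 * |y| := by gcongr
      _ = _ := by ring
  have hbound : ∀ θ z, ‖d θ z‖ ≤ ∑ p, C p * (1 + ∑ q, (|W q z| + |Y q z|)) ^ k p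
      * (|W p z| + |Y p z|) := fun θ z => by
    refine (norm_sum_le _ _).trans (Finset.sum_le_sum fun p _ => ?_)
    rw [Real.norm_eq_abs, abs_mul]
    have n1 : ‖u θ z‖ ≤ ∑ q, (|W q z| + |Y q z|) :=
      (pi_norm_le_iff_of_nonneg (by positivity)).2 fun p =>
        (tri _ _ _ _ (Real.abs_sin_le_one θ) (Real.abs_cos_le_one θ)).trans
          (Finset.single_le_sum (f := fun q => |W q z| + |Y q z|)
            (fun i _ => by positivity) (Finset.mem_univ p))
    have n2 : |Real.cos θ * W p z - Real.sin θ * Y p z| ≤ |W p z| + |Y p z| := by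
      have := tri (Real.cos θ) (-Real.sin θ) (W p z) (Y p z) (Real.abs_cos_le_one θ)
        (by simpa using Real.abs_sin_le_one θ)
      rwa [neg_mul, ← sub_eq_add_neg] at this
    have n3 : |g1 p (u θ z)| ≤ C p * (1 + ∑ q, (|W q z| + |Y q z|)) ^ k p :=
      (hb p _).trans (mul_le_mul_of_nonneg_left (by gcongr) (hC p))
    have := hC p
    exact mul_le_mul n3 n2 (abs_nonneg _) (by positivity)
  have hφ' : ∀ θ, HasDerivAt φ (∫ z, d θ z ∂μ) θ := fun θ =>
    (hasDerivAt_integral_of_dominated_loc_of_deriv_le (s := Set.univ) Filter.univ_mem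
      (Filter.Eventually.of_forall fun θ => (pg.comp (pu θ)).1.aestronglyMeasurable)
      ((pg.comp (pu θ)).integrable μ) (pd θ).1.aestronglyMeasurable
      (ae_of_all _ fun z θ _ => hbound θ z) (pbound.integrable μ)
      (ae_of_all _ fun z θ _ => hderiv θ z)).2
  set M := ∑ p, ∑ q, ∫ z, |T p q z - σ p q| ∂μ with hM
  have hval : ∀ θ, ∫ z, d θ z ∂μ = Real.sin θ * Real.cos θ *
      ∑ p, ∑ q, ∫ z, g2 p q (u θ z) * (T p q z - σ p q) ∂μ := fun θ => by
    have pg1u : ∀ p, PolyGrowth fun z => g1 p (u θ z) := fun p => (pg1 p).comp (pu θ)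
    have pg2u : ∀ p q, PolyGrowth fun z => g2 p q (u θ z) := fun p q => (pg2 p q).comp (pu θ)
    simp only [hd]
    rw [integral_finsetSum _ fun p _ => ((pg1u p).mul
      (((hW p).const_mul _).sub ((hY p).const_mul _))).integrable μ, Finset.mul_sum]
    refine Finset.sum_congr rfl fun p _ => ?_
    have e1 : ∀ z, g1 p (u θ z) * (Real.cos θ * W p z - Real.sin θ * Y p z)
        = Real.cos θ * (W p z * g1 p (u θ z)) - Real.sin θ * (Y p z * g1 p (u θ z)) :=
      fun z => by ring
    simp only [e1]
    rw [integral_sub ((((hW p).mul (pg1u p)).const_mul _).integrable μ)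
      ((((hY p).mul (pg1u p)).const_mul _).integrable μ), integral_const_mul, integral_const_mul,
      h1 θ p, h2 θ p]
    have e2 : ∀ q, ∫ z, g2 p q (u θ z) * (T p q z - σ p q) ∂μ
        = (∫ z, g2 p q (u θ z) * T p q z ∂μ) - ∫ z, g2 p q (u θ z) * σ p q ∂μ := fun q => by
      rw [← integral_sub (((pg2u p q).mul (hT p q)).integrable μ)
        (((pg2u p q).mul (PolyGrowth.const _)).integrable μ)]
      simp only [mul_sub]
    simp only [e2, Finset.sum_sub_distrib]
    ring
  have hle : ∀ θ, ‖∫ z, d θ z ∂μ‖ ≤ M := fun θ => by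
    rw [hval, norm_mul, norm_mul]
    have s1 : ‖∑ p, ∑ q, ∫ z, g2 p q (u θ z) * (T p q z - σ p q) ∂μ‖ ≤ M := by
      refine (norm_sum_le _ _).trans (Finset.sum_le_sum fun p _ => ?_)
      refine (norm_sum_le _ _).trans (Finset.sum_le_sum fun q _ => ?_)
      refine norm_integral_le_of_norm_le
        ((((hT p q).sub (PolyGrowth.const _)).abs).integrable μ) (ae_of_all _ fun z => ?_)
      rw [norm_mul, Real.norm_eq_abs, Real.norm_eq_abs]
      exact mul_le_of_le_one_left (abs_nonneg _) (hg2 _ _ _)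
    calc _ ≤ 1 * 1 * M := by
          gcongr
          · exact Real.abs_sin_le_one θ
          · exact Real.abs_cos_le_one θ
      _ = M := by ring
  have := Convex.norm_image_sub_le_of_norm_hasDerivWithin_le
    (fun θ _ => (hφ' θ).hasDerivWithinAt) (fun θ _ => hle θ) (convex_univ)
    (Set.mem_univ (0 : ℝ)) (Set.mem_univ (Real.pi / 2))
  rw [sub_zero, Real.norm_eq_abs, Real.norm_of_nonneg (by positivity), mul_comm] at this
  simpa [hφ, hu] using this

/-- The coefficients of the differential of a function on `P → ℝ`. -/
lemma fderiv_eq_sum_proj {P : Type*} [Fintype P] [DecidableEq P] (f : (P → ℝ) → ℝ) (x : P → ℝ) :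
    fderiv ℝ f x = ∑ p, fderiv ℝ f x (Pi.single p 1) •
      (ContinuousLinearMap.proj p : (P → ℝ) →L[ℝ] ℝ) := by
  ext v
  conv_lhs => rw [pi_eq_sum_univ' v]
  rw [map_sum]
  simp [mul_comm]

lemma norm_sum_smul_proj_le {P : Type*} [Fintype P] (c : P → ℝ) :
    ‖∑ p, c p • (ContinuousLinearMap.proj p : (P → ℝ) →L[ℝ] ℝ)‖ ≤ ∑ p, |c p| := by
  refine ContinuousLinearMap.opNorm_le_bound _ (by positivity) fun x => ?_
  rw [sum_apply, Finset.sum_mul]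
  refine (norm_sum_le _ _).trans (Finset.sum_le_sum fun p _ => ?_)
  simp only [smul_apply, ContinuousLinearMap.proj_apply, norm_smul,
    Real.norm_eq_abs]
  gcongr
  exact norm_le_pi_norm x p

/-- A `C²` function on `P → ℝ` with bounded second derivatives has polynomial growth, together
with its derivatives. -/
lemma polyGrowth_of_second_derivatives_le {P : Type*} [Fintype P] [DecidableEq P]
    {g : (P → ℝ) → ℝ} (hg : ContDiff ℝ 2 g)
    (hb : ∀ x p q,
      |fderiv ℝ (fun y => fderiv ℝ g y (Pi.single q 1)) x (Pi.single p 1)| ≤ 1) :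
    PolyGrowth g ∧ (∀ q, PolyGrowth fun y => fderiv ℝ g y (Pi.single q 1)) ∧
    (∀ q, Differentiable ℝ fun y => fderiv ℝ g y (Pi.single q 1)) ∧
    ∀ q p, PolyGrowth fun x =>
      fderiv ℝ (fun y => fderiv ℝ g y (Pi.single q 1)) x (Pi.single p 1) := by
  have c1 : ContDiff ℝ 1 (fderiv ℝ g) := hg.fderiv_right (by norm_num)
  have c2 : ∀ q, ContDiff ℝ 1 fun y => fderiv ℝ g y (Pi.single q 1) := fun q =>
    c1.clm_apply contDiff_const
  have d2 : ∀ q, Differentiable ℝ fun y => fderiv ℝ g y (Pi.single q 1) := fun q =>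
    (c2 q).differentiable (by norm_num)
  have p1 : ∀ q, PolyGrowth fun y => fderiv ℝ g y (Pi.single q 1) := fun q =>
    PolyGrowth.of_norm_fderiv_le (C := Fintype.card P) (k := 0) (d2 q) fun x => by
      rw [fderiv_eq_sum_proj]
      refine (norm_sum_smul_proj_le _).trans ?_
      refine (Finset.sum_le_sum fun p _ => hb x p q).trans ?_
      simp
  refine ⟨?_, p1, d2, fun q p => ⟨?_, 1, 0, fun x => by simpa using hb x p q⟩⟩
  · obtain ⟨-, C, k, h⟩ := PolyGrowth.sum Finset.univ fun q => (p1 q).abs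
    refine PolyGrowth.of_norm_fderiv_le (C := C) (k := k) (hg.differentiable (by norm_num))
      fun x => ?_
    rw [fderiv_eq_sum_proj]
    exact (norm_sum_smul_proj_le _).trans ((le_abs_self _).trans (h x))
  · exact ((c2 q).continuous_fderiv (by norm_num)).clm_apply continuous_const

lemma mul_four_le_of_rpow {x y z w : ℝ} (hx : 0 ≤ x) (hy : 0 ≤ y) (hz : 0 ≤ z) (hw : 0 ≤ w) :
    x * y * z * w ≤ (x ^ (4 / 3 : ℝ) * y ^ (4 / 3 : ℝ) * z ^ (4 / 3 : ℝ)
      + y ^ (4 / 3 : ℝ) * z ^ (4 / 3 : ℝ) * w ^ (4 / 3 : ℝ)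
      + z ^ (4 / 3 : ℝ) * w ^ (4 / 3 : ℝ) * x ^ (4 / 3 : ℝ)
      + w ^ (4 / 3 : ℝ) * x ^ (4 / 3 : ℝ) * y ^ (4 / 3 : ℝ)) / 4 := by
  have root : ∀ t : ℝ, 0 ≤ t → ∃ b, t = b ^ 3 ∧ t ^ (4 / 3 : ℝ) = b ^ 4 := fun t ht =>
    ⟨t ^ (1 / 3 : ℝ), by rw [← Real.rpow_natCast, ← Real.rpow_mul ht]; norm_num,
      by rw [← Real.rpow_natCast, ← Real.rpow_mul ht]; norm_num⟩
  obtain ⟨a, hxa, ha⟩ := root x hx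
  obtain ⟨b, hyb, hb⟩ := root y hy
  obtain ⟨c, hzc, hc⟩ := root z hz
  obtain ⟨e, hwe, he⟩ := root w hw
  rw [ha, hb, hc, he, hxa, hyb, hzc, hwe]
  have amgm : ∀ p q r t : ℝ, p * q * r * t ≤ (p ^ 4 + q ^ 4 + r ^ 4 + t ^ 4) / 4 :=
    fun p q r t => by
      nlinarith [sq_nonneg (p ^ 2 - q ^ 2), sq_nonneg (r ^ 2 - t ^ 2), sq_nonneg (p * q - r * t)]
  calc _ = (a * b * c) * (b * c * e) * (c * e * a) * (e * a * b) := by ring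
    _ ≤ _ := amgm _ _ _ _
    _ = _ := by ring

/-- Summing a product of kernels along a path. -/
lemma sum_path_le {ι : Type*} [Fintype ι] {S : ℝ} {c : ι → ι → ℝ}
    (hc : ∀ x y, 0 ≤ c x y) (hS : ∀ x, ∑ y, c x y ≤ S) :
    ∑ x, ∑ y, ∑ z, ∑ w, c x y * c y z * c z w ≤ Fintype.card ι * S ^ 3 := by
  have hx : ∀ x, ∑ y, ∑ z, ∑ w, c x y * c y z * c z w ≤ S ^ 3 := fun x => by
    have hS0 : 0 ≤ S := (Finset.sum_nonneg fun y _ => hc x y).trans (hS x)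
    calc ∑ y, ∑ z, ∑ w, c x y * c y z * c z w
        = ∑ y, c x y * ∑ z, c y z * ∑ w, c z w := by
          simp only [Finset.mul_sum, mul_assoc]
      _ ≤ ∑ y, c x y * ∑ z, c y z * S := by
          gcongr with y _ z _
          · exact hc _ _
          · exact hc _ _
          · exact hS z
      _ ≤ ∑ y, c x y * (S * S) := by
          gcongr with y _
          · exact hc _ _
          · rw [← Finset.sum_mul]
            gcongr
            exact hS y
      _ ≤ S * (S * S) := by
          rw [← Finset.sum_mul]
          gcongr
          exact hS x
      _ = S ^ 3 := by ring
  calc _ ≤ ∑ _x : ι, S ^ 3 := Finset.sum_le_sum fun x _ => hx x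
    _ = _ := by simp

/-- Young type bound for the sum of a kernel over four-cycles. -/
lemma sum_cycle_le (s : ℤ → ℝ) (d : ℕ) :
    ∑ k : Fin d, ∑ l : Fin d, ∑ k' : Fin d, ∑ l' : Fin d,
      |s ((k : ℤ) - l)| * |s ((l : ℤ) - l')| * |s ((l' : ℤ) - k')| * |s ((k' : ℤ) - k)|
    ≤ d * (∑ k ∈ Finset.Icc (-(d : ℤ)) (d : ℤ), |s k| ^ ((4 : ℝ) / 3)) ^ 3 := by
  set S := ∑ k ∈ Finset.Icc (-(d : ℤ)) (d : ℤ), |s k| ^ ((4 : ℝ) / 3) with hS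
  set c : Fin d → Fin d → ℝ := fun x y => |s ((x : ℤ) - y)| ^ ((4 : ℝ) / 3) with hc
  have hc0 : ∀ x y, 0 ≤ c x y := fun x y => by positivity
  have hrow : ∀ x, ∑ y, c x y ≤ S := fun x => by
    have hinj : Set.InjOn (fun y : Fin d => (x : ℤ) - y) (Finset.univ : Finset (Fin d)) := by
      intro y _ z _ h
      ext
      simp only at h
      omega
    rw [hS, ← Finset.sum_image (f := fun m : ℤ => |s m| ^ ((4 : ℝ) / 3)) hinj]
    refine Finset.sum_le_sum_of_subset_of_nonneg ?_ fun m _ _ => by positivity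
    intro m hm
    obtain ⟨y, -, rfl⟩ := Finset.mem_image.1 hm
    rw [Finset.mem_Icc]
    omega
  have path := sum_path_le hc0 hrow
  rw [Fintype.card_fin] at path
  have rot : ∀ F : Fin d → Fin d → Fin d → Fin d → ℝ,
      ∑ x, ∑ y, ∑ z, ∑ w, F x y z w = ∑ y, ∑ z, ∑ w, ∑ x, F x y z w := fun F => by
    rw [Finset.sum_comm]
    refine Finset.sum_congr rfl fun y _ => ?_
    rw [Finset.sum_comm]
    exact Finset.sum_congr rfl fun z _ => Finset.sum_comm
  have swap : ∀ F : Fin d → Fin d → Fin d → Fin d → ℝ,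
      ∑ x, ∑ y, ∑ z, ∑ w, F x y z w = ∑ x, ∑ y, ∑ w, ∑ z, F x y z w := fun F =>
    Finset.sum_congr rfl fun x _ => Finset.sum_congr rfl fun y _ => Finset.sum_comm
  have q1 : ∑ k, ∑ l, ∑ k', ∑ l', c k l * c l l' * c l' k' ≤ d * S ^ 3 :=
    (swap fun k l k' l' => c k l * c l l' * c l' k').trans_le path
  have q2 : ∑ k, ∑ l, ∑ k', ∑ l', c l l' * c l' k' * c k' k ≤ d * S ^ 3 :=
    ((swap fun k l k' l' => c l l' * c l' k' * c k' k).trans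
      (rot fun k l l' k' => c l l' * c l' k' * c k' k)).trans_le path
  have q3 : ∑ k, ∑ l, ∑ k', ∑ l', c l' k' * c k' k * c k l ≤ d * S ^ 3 :=
    (((swap fun k l k' l' => c l' k' * c k' k * c k l).trans
      (rot fun k l l' k' => c l' k' * c k' k * c k l)).trans
      (rot fun l l' k' k => c l' k' * c k' k * c k l)).trans_le path
  have q4 : ∑ k, ∑ l, ∑ k', ∑ l', c k' k * c k l * c l l' ≤ d * S ^ 3 :=
    ((swap fun k l k' l' => c k' k * c k l * c l l').trans
      (rot fun k' k l l' => c k' k * c k l * c l l').symm).trans_le path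
  have pt : ∀ k l k' l' : Fin d,
      |s ((k : ℤ) - l)| * |s ((l : ℤ) - l')| * |s ((l' : ℤ) - k')| * |s ((k' : ℤ) - k)|
      ≤ (c k l * c l l' * c l' k' + c l l' * c l' k' * c k' k + c l' k' * c k' k * c k l
        + c k' k * c k l * c l l') / 4 := fun k l k' l' =>
    mul_four_le_of_rpow (abs_nonneg _) (abs_nonneg _) (abs_nonneg _) (abs_nonneg _)
  calc _ ≤ ∑ k, ∑ l, ∑ k', ∑ l', (c k l * c l l' * c l' k' + c l l' * c l' k' * c k' k
        + c l' k' * c k' k * c k l + c k' k * c k l * c l l') / 4 := by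
        gcongr with k _ l _ k' _ l' _
        exact pt k l k' l'
    _ ≤ _ := by
        simp only [← Finset.sum_div, Finset.sum_add_distrib]
        linarith

/-- Joint law of a centered Gaussian family indexed by a finite type. -/
lemma IsCenteredGaussianFamily.isGaussian_map {Ω ι : Type*} [MeasureSpace Ω] [Fintype ι]
    {X : ι → Ω → ℝ} (h : IsCenteredGaussianFamily X) :
    AEMeasurable (fun ω i => X i ω) volume ∧
      IsGaussian (volume.map fun ω i => X i ω) ∧
      ∀ a, ∫ x : ι → ℝ, x a ∂(volume.map fun ω i => X i ω) = 0 := by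
  classical
  have hX : ∀ i, AEMeasurable (X i) volume := fun i => by
    obtain ⟨v, hv⟩ := h {i} 1
    simp only [Finset.sum_singleton, Pi.one_apply, one_mul] at hv
    refine aemeasurable_of_map_neZero (μ := (volume : Measure Ω)) (f := X i) ?_
    rw [hv]
    infer_instance
  have hXm : AEMeasurable (fun ω i => X i ω) volume := aemeasurable_pi_lambda _ hX
  have hL : ∀ L : StrongDual ℝ (ι → ℝ), ∃ v,
      (volume.map fun ω i => X i ω).map L = gaussianReal 0 v := fun L => by
    obtain ⟨v, hv⟩ := h Finset.univ fun i => L (Pi.single i 1)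
    refine ⟨v, ?_⟩
    rw [AEMeasurable.map_map_of_aemeasurable L.continuous.aemeasurable hXm, ← hv]
    congr 1
    ext ω
    simp only [Function.comp_apply]
    conv_lhs => rw [pi_eq_sum_univ' (fun i => X i ω)]
    simp only [map_sum, map_smul, smul_eq_mul]
    refine Finset.sum_congr rfl fun i _ => ?_
    rw [mul_comm]
  refine ⟨hXm, isGaussian_of_map_eq_gaussianReal fun L => ?_, fun a => ?_⟩
  · obtain ⟨v, hv⟩ := hL L
    exact ⟨0, v, hv⟩
  · obtain ⟨v, hv⟩ := hL (ContinuousLinearMap.proj a)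
    have : ∫ t, t ∂((volume.map fun ω i => X i ω).map
        (ContinuousLinearMap.proj a : StrongDual ℝ (ι → ℝ))) = 0 := by
      rw [hv, integral_id_gaussianReal]
    rwa [integral_map (f := fun t : ℝ => t) (ContinuousLinearMap.continuous _).aemeasurable
      aestronglyMeasurable_id] at this

section GaussianPi

variable {ι : Type*} [Fintype ι] {μ : Measure (ι → ℝ)} [IsGaussian μ] {K : ι → ι → ℝ}

lemma polyGrowth_apply (a : ι) : PolyGrowth fun x : ι → ℝ => x a :=
  PolyGrowth.dual (ContinuousLinearMap.proj a : StrongDual ℝ (ι → ℝ))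

lemma dual_apply_covariance (hK : ∀ a b, ∫ x, x a * x b ∂μ = K a b) (a : ι)
    (M : StrongDual ℝ (ι → ℝ)) : M (K a) = ∫ x, x a * M x ∂μ := by
  classical
  have hM : ∀ y, M y = ∑ b, M (Pi.single b 1) * y b := fun y => by
    conv_lhs => rw [← Finset.univ_sum_single y]
    rw [map_sum]
    refine Finset.sum_congr rfl fun b _ => ?_
    rw [mul_comm, ← smul_eq_mul, ← map_smul, ← Pi.single_smul, smul_eq_mul, mul_one]
  have e : ∀ x : ι → ℝ, x a * M x = ∑ b, M (Pi.single b 1) * (x a * x b) := fun x => by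
    rw [hM x, Finset.mul_sum]
    exact Finset.sum_congr rfl fun b _ => by ring
  simp only [e]
  rw [hM, integral_finsetSum _ fun b _ =>
    ((((polyGrowth_apply a).mul (polyGrowth_apply b)).const_mul _).integrable μ)]
  simp only [integral_const_mul, hK]

/-- Gaussian integration by parts. -/
lemma integral_apply_mul_eq (hm : ∀ a, ∫ x, x a ∂μ = 0)
    (hK : ∀ a b, ∫ x, x a * x b ∂μ = K a b) (a : ι) {F D : (ι → ℝ) → ℝ}
    (hF : ∀ x, HasDerivAt (fun t : ℝ => F (x + t • K a)) (D x) 0)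
    (pF : PolyGrowth F) (pD : PolyGrowth D) : ∫ x, x a * F x ∂μ = ∫ x, D x ∂μ :=
  integral_dual_mul_of_isGaussian μ (ContinuousLinearMap.proj a) (K a) (hm a)
    (dual_apply_covariance hK a) hF pF.1 pD.1 (pF.integrable μ) (pD.integrable μ)
    (((polyGrowth_apply a).mul pF).integrable μ)

lemma hasDerivAt_add_smul_zero (x y : ℝ) : HasDerivAt (fun t : ℝ => x + t * y) y 0 := by
  simpa using ((hasDerivAt_id (0 : ℝ)).mul_const y).const_add x

/-- The Isserlis formula for fourth moments. -/
lemma integral_mul_mul_mul_eq (hm : ∀ a, ∫ x, x a ∂μ = 0)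
    (hK : ∀ a b, ∫ x, x a * x b ∂μ = K a b) (a b c e : ι) :
    ∫ x, (x a * x b) * (x c * x e) ∂μ = K a b * K c e + K a c * K b e + K a e * K b c := by
  have p := fun i => polyGrowth_apply (ι := ι) i
  have i2 := fun i j => ((p i).mul (p j)).integrable μ
  have := integral_apply_mul_eq hm hK a (F := fun x => x b * (x c * x e))
    (D := fun x => K a b * (x c * x e) + (K a c * (x b * x e) + K a e * (x b * x c)))
    (fun x => by
      have := (hasDerivAt_add_smul_zero (x b) (K a b)).mul
        ((hasDerivAt_add_smul_zero (x c) (K a c)).mul (hasDerivAt_add_smul_zero (x e) (K a e)))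
      refine this.congr_deriv ?_
      simp
      ring)
    ((p b).mul ((p c).mul (p e)))
    ((((p c).mul (p e)).const_mul _).add
      ((((p b).mul (p e)).const_mul _).add (((p b).mul (p c)).const_mul _)))
  simp only [mul_assoc]
  have j : Integrable (fun x => K a c * (x b * x e) + K a e * (x b * x c)) μ :=
    ((i2 b e).const_mul _).add ((i2 b c).const_mul _)
  rw [this, integral_add ((i2 c e).const_mul _) j,
    integral_add ((i2 b e).const_mul _) ((i2 b c).const_mul _)]
  simp only [integral_const_mul, hK]
  ring

end GaussianPi

section GaussianProd

variable {ι P : Type*} [Fintype ι] [Fintype P] {μ : Measure (ι → ℝ)} [IsGaussian μ]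
  {ν : Measure (P → ℝ)} [IsGaussian ν] {K : ι → ι → ℝ} {σ : P → P → ℝ}

/-- Gaussian integration by parts in the first of two independent Gaussian vectors. -/
lemma integral_fst_apply_mul_eq (hm : ∀ a, ∫ x, x a ∂μ = 0)
    (hK : ∀ a b, ∫ x, x a * x b ∂μ = K a b) (a : ι) {F D : (ι → ℝ) × (P → ℝ) → ℝ}
    (hF : ∀ z, HasDerivAt (fun t : ℝ => F (z.1 + t • K a, z.2)) (D z) 0)
    (pF : PolyGrowth F) (pD : PolyGrowth D) :
    ∫ z, z.1 a * F z ∂(μ.prod ν) = ∫ z, D z ∂(μ.prod ν) := by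
  let L : StrongDual ℝ ((ι → ℝ) × (P → ℝ)) :=
    (ContinuousLinearMap.proj a).comp (ContinuousLinearMap.fst ℝ (ι → ℝ) (P → ℝ))
  have hL0 : ∫ z, L z ∂(μ.prod ν) = 0 := by
    have := integral_prod_mul (μ := μ) (ν := ν) (fun x : ι → ℝ => x a) fun _ => (1 : ℝ)
    simpa [hm, L] using this
  refine integral_dual_mul_of_isGaussian (μ.prod ν) L (K a, 0) hL0 (fun M => ?_)
    (by simpa using hF) pF.1 pD.1 (pF.integrable _) (pD.integrable _)
    (((PolyGrowth.dual L).mul pF).integrable _)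
  let M1 := M.comp (ContinuousLinearMap.inl ℝ (ι → ℝ) (P → ℝ))
  let M2 := M.comp (ContinuousLinearMap.inr ℝ (ι → ℝ) (P → ℝ))
  have e : ∀ z, L z * M z = (z.1 a * M1 z.1) * 1 + z.1 a * M2 z.2 := fun z => by
    have : M z = M1 z.1 + M2 z.2 := by
      simp only [M1, M2, ContinuousLinearMap.comp_apply, ← map_add]
      simp
    rw [this]
    simp only [L, ContinuousLinearMap.comp_apply, ContinuousLinearMap.coe_fst',
      ContinuousLinearMap.proj_apply]
    ring
  have j1 := (PolyGrowth.mul (polyGrowth_apply a) (PolyGrowth.dual M1)).integrable μ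
  have j2 := (polyGrowth_apply a).integrable μ
  have j3 := (PolyGrowth.dual M2).integrable ν
  simp only [e]
  rw [integral_add (j1.mul_prod (integrable_const 1)) (j2.mul_prod j3),
    integral_prod_mul (fun x : ι → ℝ => x a * M1 x) fun _ => (1 : ℝ),
    integral_prod_mul (fun x : ι → ℝ => x a) fun y => M2 y, hm, ← dual_apply_covariance hK]
  simp [M1]

/-- Gaussian integration by parts in the second of two independent Gaussian vectors. -/
lemma integral_snd_apply_mul_eq (hm : ∀ p, ∫ y, y p ∂ν = 0)
    (hσ : ∀ p q, ∫ y, y p * y q ∂ν = σ p q) (p : P) {F D : (ι → ℝ) × (P → ℝ) → ℝ}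
    (hF : ∀ z, HasDerivAt (fun t : ℝ => F (z.1, z.2 + t • σ p)) (D z) 0)
    (pF : PolyGrowth F) (pD : PolyGrowth D) :
    ∫ z, z.2 p * F z ∂(μ.prod ν) = ∫ z, D z ∂(μ.prod ν) := by
  have swp : ∀ f : (ι → ℝ) × (P → ℝ) → ℝ,
      ∫ z, f z ∂(μ.prod ν) = ∫ z, f z.swap ∂(ν.prod μ) := fun f =>
    (integral_prod_swap f).symm
  have pS : ∀ {f : (ι → ℝ) × (P → ℝ) → ℝ}, PolyGrowth f →
      PolyGrowth fun z : (P → ℝ) × (ι → ℝ) => f z.swap :=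
    fun {f} hf => by
      obtain ⟨hc, C, k, h⟩ := hf
      refine ⟨hc.comp continuous_swap, C, k, fun x => (h _).trans_eq ?_⟩
      rw [Prod.norm_def, Prod.norm_def, max_comm]
      rfl
  rw [swp, swp]
  exact integral_fst_apply_mul_eq hm hσ p (F := fun z => F z.swap) (D := fun z => D z.swap)
    (fun z => hF z.swap) (pS pF) (pS pD)

end GaussianProd

lemma PolyGrowth.sq_integral_abs_le {E : Type*} [NormedAddCommGroup E] [NormedSpace ℝ E]
    [MeasurableSpace E] [BorelSpace E] [CompleteSpace E] [SecondCountableTopology E] {f : E → ℝ}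
    (hf : PolyGrowth f) (μ : Measure E) [IsGaussian μ] :
    (∫ x, |f x| ∂μ) ^ 2 ≤ ∫ x, f x ^ 2 ∂μ := by
  set m := ∫ x, |f x| ∂μ with hm
  have h0 : 0 ≤ ∫ x, (|f x| - m) ^ 2 ∂μ := integral_nonneg fun x => sq_nonneg _
  have e : ∀ x, (|f x| - m) ^ 2 = f x ^ 2 - (2 * m * |f x| - m ^ 2) := fun x => by
    rw [sub_sq, sq_abs]
    ring
  have i1 : Integrable (fun x => 2 * m * |f x|) μ := (hf.abs.const_mul _).integrable μ
  have i2 : Integrable (fun x => 2 * m * |f x| - m ^ 2) μ := i1.sub (integrable_const _)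
  simp only [e] at h0
  rw [integral_sub ((hf.pow 2).integrable μ) i2,
    integral_sub i1 (integrable_const _), integral_const_mul, ← hm] at h0
  simp only [integral_const, probReal_univ, one_smul] at h0
  linarith

section GaussianPi

variable {ι : Type*} [Fintype ι] {μ : Measure (ι → ℝ)} [IsGaussian μ] {K : ι → ι → ℝ}

lemma integral_mul_sub_mul_mul_sub_eq (hm : ∀ a, ∫ x, x a ∂μ = 0)
    (hK : ∀ a b, ∫ x, x a * x b ∂μ = K a b) (a b c e : ι) :
    ∫ x, (x a * x b - K a b) * (x c * x e - K c e) ∂μ = K a c * K b e + K a e * K b c := by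
  have p := fun i j => (polyGrowth_apply (ι := ι) i).mul (polyGrowth_apply j)
  have h : ∀ x : ι → ℝ, (x a * x b - K a b) * (x c * x e - K c e) = (x a * x b) * (x c * x e)
      - (K a b * (x c * x e) + (K c e * (x a * x b) - K a b * K c e)) := fun x => by ring
  have i1 := ((p c e).const_mul (K a b)).integrable μ
  have i2 := ((p a b).const_mul (K c e)).integrable μ
  have i3 : Integrable (fun x => K c e * (x a * x b) - K a b * K c e) μ :=
    i2.sub (integrable_const _)
  have i4 : Integrable (fun x => K a b * (x c * x e)
    + (K c e * (x a * x b) - K a b * K c e)) μ := i1.add i3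
  simp only [h]
  rw [integral_sub (((p a b).mul (p c e)).integrable μ) i4, integral_add i1 i3,
    integral_sub i2 (integrable_const _), integral_mul_mul_mul_eq hm hK]
  simp only [integral_const_mul, hK, integral_const, probReal_univ, one_smul]
  ring

end GaussianPi

section Wishart

variable {n d : ℕ} {r s : ℤ → ℝ}

/-- Covariance of the entries of a Gaussian matrix with overall correlation `(r, s)`. -/
def overallCov (n d : ℕ) (r s : ℤ → ℝ) (a b : Fin n × Fin d) : ℝ :=
  r ((a.1 : ℤ) - b.1) * s ((a.2 : ℤ) - b.2)

/-- Fluctuation of the `s`-weighted empirical correlation between the rows `j` and `b`. -/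
noncomputable def weightedFluctuation (r s : ℤ → ℝ) (j b : Fin n) (x : Fin n × Fin d → ℝ) : ℝ :=
  (d : ℝ)⁻¹ * ∑ k : Fin d, ∑ l : Fin d,
    s ((k : ℤ) - l) * (x (j, k) * x (b, l) - overallCov n d r s (j, k) (b, l))

lemma polyGrowth_weightedFluctuation (j b : Fin n) :
    PolyGrowth (weightedFluctuation (d := d) r s j b) :=
  (PolyGrowth.sum _ fun _ => PolyGrowth.sum _ fun _ =>
    (((polyGrowth_apply _).mul (polyGrowth_apply _)).sub (PolyGrowth.const _)).const_mul
      _).const_mul _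

variable {μ : Measure (Fin n × Fin d → ℝ)} [IsGaussian μ]

lemma integral_sq_weightedFluctuation_le (hs : ∀ k, s (-k) = s k) (hr0 : r 0 = 1)
    (hr1 : ∀ k, |r k| ≤ 1) (hm : ∀ a, ∫ x, x a ∂μ = 0)
    (hK : ∀ a b, ∫ x, x a * x b ∂μ = overallCov n d r s a b) (j b : Fin n) :
    ∫ x, weightedFluctuation r s j b x ^ 2 ∂μ
      ≤ 2 * (∑ k ∈ Finset.Icc (-(d : ℤ)) (d : ℤ), |s k| ^ ((4 : ℝ) / 3)) ^ 3 / d := by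
  set S := ∑ k ∈ Finset.Icc (-(d : ℤ)) (d : ℤ), |s k| ^ ((4 : ℝ) / 3) with hS
  set f : Fin d → Fin d → (Fin n × Fin d → ℝ) → ℝ := fun k l x =>
    x (j, k) * x (b, l) - overallCov n d r s (j, k) (b, l) with hf
  have pf : ∀ k l, PolyGrowth (f k l) := fun k l =>
    ((polyGrowth_apply _).mul (polyGrowth_apply _)).sub (PolyGrowth.const _)
  have hsq : ∀ x, weightedFluctuation r s j b x ^ 2 = (d : ℝ)⁻¹ ^ 2 *
      ∑ k : Fin d, ∑ l : Fin d, ∑ k' : Fin d, ∑ l' : Fin d,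
        s ((k : ℤ) - l) * s ((k' : ℤ) - l') * (f k l x * f k' l' x) := fun x => by
    rw [weightedFluctuation, mul_pow]
    congr 1
    rw [sq]
    simp only [Finset.sum_mul, Finset.mul_sum]
    refine Finset.sum_congr rfl fun k _ => Finset.sum_congr rfl fun l _ =>
      Finset.sum_congr rfl fun k' _ => Finset.sum_congr rfl fun l' _ => ?_
    simp only [hf]
    ring
  have hI : ∀ k l k' l' : Fin d, Integrable
      (fun x => s ((k : ℤ) - l) * s ((k' : ℤ) - l') * (f k l x * f k' l' x)) μ :=
    fun k l k' l' => (((pf k l).mul (pf k' l')).const_mul _).integrable μ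
  have abs_symm : ∀ k l : Fin d, |s ((k : ℤ) - l)| = |s ((l : ℤ) - k)| := fun k l => by
    rw [← hs, neg_sub]
  set cyc : Fin d → Fin d → Fin d → Fin d → ℝ := fun k l k' l' =>
    |s ((k : ℤ) - l)| * |s ((l : ℤ) - l')| * |s ((l' : ℤ) - k')| * |s ((k' : ℤ) - k)| with hcyc
  have hterm : ∀ k l k' l' : Fin d,
      ∫ x, s ((k : ℤ) - l) * s ((k' : ℤ) - l') * (f k l x * f k' l' x) ∂μ
        ≤ cyc k l k' l' + cyc k l l' k' := fun k l k' l' => by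
    rw [integral_const_mul, integral_mul_sub_mul_mul_sub_eq hm hK]
    simp only [overallCov, sub_self, hr0, one_mul, hcyc]
    have e1 : s ((k : ℤ) - l) * s ((k' : ℤ) - l') * (s ((k : ℤ) - k') * s ((l : ℤ) - l'))
        ≤ |s ((k : ℤ) - l)| * |s ((l : ℤ) - l')| * |s ((l' : ℤ) - k')| * |s ((k' : ℤ) - k)| := by
      refine (le_abs_self _).trans_eq ?_
      simp only [abs_mul]
      rw [abs_symm k' l', abs_symm k k']
      ring
    have e2 : s ((k : ℤ) - l) * s ((k' : ℤ) - l') * (r ((j : ℤ) - b) * s ((k : ℤ) - l')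
          * (r ((b : ℤ) - j) * s ((l : ℤ) - k')))
        ≤ |s ((k : ℤ) - l)| * |s ((l : ℤ) - k')| * |s ((k' : ℤ) - l')| * |s ((l' : ℤ) - k)| := by
      refine (le_abs_self _).trans ?_
      simp only [abs_mul]
      rw [abs_symm k l']
      calc _ = |r ((j : ℤ) - b)| * |r ((b : ℤ) - j)| * (|s ((k : ℤ) - l)| * |s ((l : ℤ) - k')|
              * |s ((k' : ℤ) - l')| * |s ((l' : ℤ) - k)|) := by ring
        _ ≤ 1 * 1 * (|s ((k : ℤ) - l)| * |s ((l : ℤ) - k')|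
              * |s ((k' : ℤ) - l')| * |s ((l' : ℤ) - k)|) := by
            gcongr
            · exact hr1 _
            · exact hr1 _
        _ = _ := by ring
    linarith
  have hcycle : ∑ k, ∑ l, ∑ k', ∑ l', cyc k l k' l' ≤ d * S ^ 3 := sum_cycle_le s d
  have hcycle' : ∑ k, ∑ l, ∑ k', ∑ l', cyc k l l' k' ≤ d * S ^ 3 :=
    le_of_eq_of_le (Finset.sum_congr rfl fun k _ => Finset.sum_congr rfl fun l _ =>
      Finset.sum_comm) hcycle
  simp only [hsq]
  rw [integral_const_mul, integral_finsetSum _ fun k _ => integrable_finsetSum _ fun l _ =>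
    integrable_finsetSum _ fun k' _ => integrable_finsetSum _ fun l' _ => hI k l k' l']
  have hsum : ∑ k : Fin d, ∫ x, ∑ l : Fin d, ∑ k' : Fin d, ∑ l' : Fin d,
      s ((k : ℤ) - l) * s ((k' : ℤ) - l') * (f k l x * f k' l' x) ∂μ ≤ 2 * (d * S ^ 3) := by
    calc _ = ∑ k : Fin d, ∑ l : Fin d, ∑ k' : Fin d, ∑ l' : Fin d,
        ∫ x, s ((k : ℤ) - l) * s ((k' : ℤ) - l') * (f k l x * f k' l' x) ∂μ := by
          refine Finset.sum_congr rfl fun k _ => ?_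
          rw [integral_finsetSum _ fun l _ => integrable_finsetSum _ fun k' _ =>
            integrable_finsetSum _ fun l' _ => hI k l k' l']
          refine Finset.sum_congr rfl fun l _ => ?_
          rw [integral_finsetSum _ fun k' _ => integrable_finsetSum _ fun l' _ => hI k l k' l']
          exact Finset.sum_congr rfl fun k' _ => integral_finsetSum _ fun l' _ => hI k l k' l'
      _ ≤ ∑ k, ∑ l, ∑ k', ∑ l', (cyc k l k' l' + cyc k l l' k') := by
          gcongr with k _ l _ k' _ l' _
          exact hterm k l k' l'
      _ ≤ 2 * (d * S ^ 3) := by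
          simp only [Finset.sum_add_distrib]
          linarith
  calc _ ≤ (d : ℝ)⁻¹ ^ 2 * (2 * (d * S ^ 3)) := by gcongr
    _ = _ := by
      rcases eq_or_ne (d : ℝ) 0 with h | h
      · simp [h]
      · field_simp

lemma integral_abs_weightedFluctuation_le (hs : ∀ k, s (-k) = s k) (hr0 : r 0 = 1)
    (hr1 : ∀ k, |r k| ≤ 1) (hm : ∀ a, ∫ x, x a ∂μ = 0)
    (hK : ∀ a b, ∫ x, x a * x b ∂μ = overallCov n d r s a b) (j b : Fin n) :
    ∫ x, |weightedFluctuation r s j b x| ∂μ ≤ √2 / √d *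
      (∑ k ∈ Finset.Icc (-(d : ℤ)) (d : ℤ), |s k| ^ ((4 : ℝ) / 3)) ^ ((3 : ℝ) / 2) := by
  set S := ∑ k ∈ Finset.Icc (-(d : ℤ)) (d : ℤ), |s k| ^ ((4 : ℝ) / 3) with hS
  have hS0 : 0 ≤ S := Finset.sum_nonneg fun k _ => by positivity
  refine le_of_pow_le_pow_left₀ two_ne_zero (by positivity) ?_
  refine ((polyGrowth_weightedFluctuation j b).sq_integral_abs_le μ).trans ?_
  refine (integral_sq_weightedFluctuation_le hs hr0 hr1 hm hK j b).trans_eq ?_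
  rw [mul_pow, div_pow, Real.sq_sqrt zero_le_two, Real.sq_sqrt (Nat.cast_nonneg d),
    ← Real.rpow_natCast (S ^ ((3 : ℝ) / 2)), ← Real.rpow_mul hS0,
    show (3 : ℝ) / 2 * ((2 : ℕ) : ℝ) = ((3 : ℕ) : ℝ) by norm_num, Real.rpow_natCast]
  ring

end Wishart

section Wishart

variable {n d : ℕ} {r s : ℤ → ℝ}

/-- Entry of the shifted Wishart matrix built from the Gaussian matrix `x`. -/
noncomputable def wishartEntry (r : ℤ → ℝ) (p : Fin n × Fin n) (x : Fin n × Fin d → ℝ) : ℝ :=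
  1 / √d * ∑ k : Fin d, (x (p.1, k) * x (p.2, k) - r ((p.1 : ℤ) - p.2))

/-- Derivative of `wishartEntry r q` in the covariance direction of the coordinate `(i, k)`. -/
noncomputable def wishartEntryDeriv (r s : ℤ → ℝ) (i : Fin n) (k : Fin d) (q : Fin n × Fin n)
    (x : Fin n × Fin d → ℝ) : ℝ :=
  1 / √d * ∑ l : Fin d, (overallCov n d r s (i, k) (q.1, l) * x (q.2, l)
    + x (q.1, l) * overallCov n d r s (i, k) (q.2, l))

/-- Kernel in the integration by parts formula for the shifted Wishart matrix. -/
noncomputable def wishartKernel (r s : ℤ → ℝ) (p q : Fin n × Fin n) (x : Fin n × Fin d → ℝ) : ℝ :=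
  1 / √d * ∑ k : Fin d, x (p.2, k) * wishartEntryDeriv r s p.1 k q x

lemma hasDerivAt_wishartEntry (i : Fin n) (k : Fin d) (q : Fin n × Fin n)
    (x : Fin n × Fin d → ℝ) :
    HasDerivAt (fun t : ℝ => wishartEntry r q (x + t • overallCov n d r s (i, k)))
      (wishartEntryDeriv r s i k q x) 0 := by
  have := HasDerivAt.fun_sum (u := Finset.univ) fun (l : Fin d) _ =>
    ((hasDerivAt_add_smul_zero (x (q.1, l)) (overallCov n d r s (i, k) (q.1, l))).mul
      (hasDerivAt_add_smul_zero (x (q.2, l)) (overallCov n d r s (i, k) (q.2, l)))).sub_const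
      (r ((q.1 : ℤ) - q.2))
  refine (this.const_mul (1 / √d)).congr_deriv ?_
  simp [wishartEntryDeriv]

lemma PolyGrowth.comp_clm {E ι : Type*} [NormedAddCommGroup E] [NormedSpace ℝ E] [Fintype ι]
    {f : (ι → ℝ) → ℝ} (hf : PolyGrowth f)
    (A : E →L[ℝ] (ι → ℝ)) : PolyGrowth fun z => f (A z) :=
  hf.comp fun a => PolyGrowth.dual ((ContinuousLinearMap.proj a).comp A)

lemma polyGrowth_wishartEntry (p : Fin n × Fin n) :
    PolyGrowth (wishartEntry (d := d) r p) :=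
  (PolyGrowth.sum _ fun _ =>
    ((polyGrowth_apply _).mul (polyGrowth_apply _)).sub (PolyGrowth.const _)).const_mul _

lemma polyGrowth_wishartEntryDeriv (i : Fin n) (k : Fin d) (q : Fin n × Fin n) :
    PolyGrowth (wishartEntryDeriv r s i k q) :=
  (PolyGrowth.sum _ fun _ => ((polyGrowth_apply _).const_mul _).add
    ((polyGrowth_apply _).mul (PolyGrowth.const _))).const_mul _

lemma polyGrowth_wishartKernel (p q : Fin n × Fin n) :
    PolyGrowth (wishartKernel (d := d) r s p q) :=
  (PolyGrowth.sum _ fun _ =>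
    (polyGrowth_apply _).mul (polyGrowth_wishartEntryDeriv _ _ _)).const_mul _

variable {P : Type*} [Fintype P] (ρ : P → Fin n × Fin n)
  {μ : Measure (Fin n × Fin d → ℝ)} [IsGaussian μ] {ν : Measure (P → ℝ)} [IsGaussian ν]
  {f : (P → ℝ) → ℝ} {f' : P → (P → ℝ) → ℝ}

/-- Integration by parts for a shifted Wishart entry against a function of the interpolation. -/
lemma integral_wishartEntry_mul_eq (hs0 : s 0 = 1) (hm : ∀ a, ∫ x, x a ∂μ = 0)
    (hK : ∀ a b, ∫ x, x a * x b ∂μ = overallCov n d r s a b)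
    (hf : ∀ x, HasFDerivAt f (∑ q, f' q x • (ContinuousLinearMap.proj q : (P → ℝ) →L[ℝ] ℝ)) x)
    (pf : PolyGrowth f) (pf' : ∀ q, PolyGrowth (f' q)) (α β : ℝ) (p : Fin n × Fin n) :
    ∫ z, wishartEntry r p z.1 * f (fun q => α * wishartEntry r (ρ q) z.1 + β * z.2 q) ∂(μ.prod ν)
      = α * ∑ q, ∫ z, f' q (fun q => α * wishartEntry r (ρ q) z.1 + β * z.2 q)
          * wishartKernel r s p (ρ q) z.1 ∂(μ.prod ν) := by
  set u : (Fin n × Fin d → ℝ) × (P → ℝ) → P → ℝ := fun z q =>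
    α * wishartEntry r (ρ q) z.1 + β * z.2 q with hu
  let A1 := ContinuousLinearMap.fst ℝ (Fin n × Fin d → ℝ) (P → ℝ)
  let A2 := ContinuousLinearMap.snd ℝ (Fin n × Fin d → ℝ) (P → ℝ)
  have px : ∀ a, PolyGrowth fun z : (Fin n × Fin d → ℝ) × (P → ℝ) => z.1 a := fun a =>
    (polyGrowth_apply a).comp_clm A1
  have pD : ∀ k q, PolyGrowth fun z : (Fin n × Fin d → ℝ) × (P → ℝ) =>
      wishartEntryDeriv r s p.1 k q z.1 := fun k q =>
    (polyGrowth_wishartEntryDeriv p.1 k q).comp_clm A1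
  have pu : ∀ q, PolyGrowth fun z => u z q := fun q =>
    (((polyGrowth_wishartEntry (ρ q)).comp_clm A1).const_mul α).add
      (((polyGrowth_apply q).comp_clm A2).const_mul β)
  have pfu : PolyGrowth fun z => f (u z) := pf.comp pu
  have pfu' : ∀ q, PolyGrowth fun z => f' q (u z) := fun q => (pf' q).comp pu
  have hderiv : ∀ (k : Fin d) z, HasDerivAt (fun t : ℝ =>
      f (u (z.1 + t • overallCov n d r s (p.1, k), z.2)))
      (∑ q, f' q (u z) * (α * wishartEntryDeriv r s p.1 k (ρ q) z.1)) 0 := fun k z => by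
    have h1 : HasDerivAt (fun t : ℝ => u (z.1 + t • overallCov n d r s (p.1, k), z.2))
        (fun q => α * wishartEntryDeriv r s p.1 k (ρ q) z.1) 0 :=
      hasDerivAt_pi.2 fun q =>
        ((hasDerivAt_wishartEntry p.1 k (ρ q) z.1).const_mul α).add_const
          (β * z.2 q)
    have h2 := (hf (u (z.1 + (0 : ℝ) • overallCov n d r s (p.1, k), z.2))).comp_hasDerivAt
      (0 : ℝ) h1
    refine h2.congr_deriv ?_
    simp
  have key : ∀ k : Fin d, ∫ z, z.1 (p.1, k) * (z.1 (p.2, k) * f (u z)) ∂(μ.prod ν)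
      = ∫ z, (r ((p.1 : ℤ) - p.2) * f (u z) + z.1 (p.2, k) *
        ∑ q, f' q (u z) * (α * wishartEntryDeriv r s p.1 k (ρ q) z.1)) ∂(μ.prod ν) := fun k => by
    refine integral_fst_apply_mul_eq hm hK (p.1, k)
      (F := fun z => z.1 (p.2, k) * f (u z)) (fun z => ?_) ((px _).mul pfu)
      ((pfu.const_mul _).add ((px _).mul (PolyGrowth.sum _ fun q =>
        (pfu' q).mul ((pD k (ρ q)).const_mul α))))
    refine ((hasDerivAt_add_smul_zero (z.1 (p.2, k))
      (overallCov n d r s (p.1, k) (p.2, k))).mul (hderiv k z)).congr_deriv ?_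
    simp [overallCov, hs0]
  have hL : ∀ z : (Fin n × Fin d → ℝ) × (P → ℝ), wishartEntry r p z.1 * f (u z) = 1 / √d *
      ∑ k : Fin d, (z.1 (p.1, k) * (z.1 (p.2, k) * f (u z)) - r ((p.1 : ℤ) - p.2) * f (u z)) :=
    fun z => by
      rw [wishartEntry, mul_assoc, Finset.sum_mul]
      congr 1
      exact Finset.sum_congr rfl fun k _ => by ring
  have j1 : ∀ k : Fin d, Integrable (fun z => z.1 (p.1, k) * (z.1 (p.2, k) * f (u z)))
      (μ.prod ν) := fun k => ((px _).mul ((px _).mul pfu)).integrable _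
  have j2 : Integrable (fun z => r ((p.1 : ℤ) - p.2) * f (u z)) (μ.prod ν) :=
    (pfu.const_mul _).integrable _
  have pt : ∀ (k : Fin d) q, PolyGrowth fun z => f' q (u z) *
      (z.1 (p.2, k) * wishartEntryDeriv r s p.1 k (ρ q) z.1) := fun k q =>
    (pfu' q).mul ((px _).mul (pD k (ρ q)))
  have hk : ∀ k : Fin d, ∫ z, (z.1 (p.1, k) * (z.1 (p.2, k) * f (u z))
      - r ((p.1 : ℤ) - p.2) * f (u z)) ∂(μ.prod ν)
      = α * ∑ q, ∫ z, f' q (u z) * (z.1 (p.2, k) * wishartEntryDeriv r s p.1 k (ρ q) z.1)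
        ∂(μ.prod ν) := fun k => by
    rw [integral_sub (j1 k) j2, key, ← integral_sub _ j2]
    · rw [← integral_finsetSum _ fun q _ => (pt k q).integrable _, ← integral_const_mul]
      refine integral_congr_ae (ae_of_all _ fun z => ?_)
      simp only [Finset.mul_sum, add_sub_cancel_left]
      exact Finset.sum_congr rfl fun q _ => by ring
    · exact ((pfu.const_mul _).add ((px _).mul (PolyGrowth.sum _ fun q =>
        (pfu' q).mul ((pD k (ρ q)).const_mul α)))).integrable _
  have j3 : ∀ k : Fin d, Integrable (fun z => z.1 (p.1, k) * (z.1 (p.2, k) * f (u z))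
      - r ((p.1 : ℤ) - p.2) * f (u z)) (μ.prod ν) := fun k => (j1 k).sub j2
  rw [integral_congr_ae (ae_of_all _ hL)]
  rw [integral_const_mul, integral_finsetSum _ fun k _ => j3 k,
    Finset.sum_congr rfl fun k _ => hk k, ← Finset.mul_sum, Finset.sum_comm, mul_left_comm,
    Finset.mul_sum]
  congr 1
  refine Finset.sum_congr rfl fun q _ => ?_
  rw [← integral_finsetSum _ fun k _ => (pt k q).integrable _, ← integral_const_mul]
  refine integral_congr_ae (ae_of_all _ fun z => ?_)
  simp only [wishartKernel, Finset.mul_sum]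
  exact Finset.sum_congr rfl fun k _ => by ring

/-- Integration by parts for the Gaussian vector against a function of the interpolation. -/
lemma integral_gaussian_mul_eq {σ : P → P → ℝ} (hm : ∀ p, ∫ y, y p ∂ν = 0)
    (hσ : ∀ p q, ∫ y, y p * y q ∂ν = σ p q)
    (hf : ∀ x, HasFDerivAt f (∑ q, f' q x • (ContinuousLinearMap.proj q : (P → ℝ) →L[ℝ] ℝ)) x)
    (pf : PolyGrowth f) (pf' : ∀ q, PolyGrowth (f' q)) (α β : ℝ) (p : P) :
    ∫ z, z.2 p * f (fun q => α * wishartEntry r (ρ q) z.1 + β * z.2 q) ∂(μ.prod ν)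
      = β * ∑ q, ∫ z, f' q (fun q => α * wishartEntry r (ρ q) z.1 + β * z.2 q)
          * σ p q ∂(μ.prod ν) := by
  set u : (Fin n × Fin d → ℝ) × (P → ℝ) → P → ℝ := fun z q =>
    α * wishartEntry r (ρ q) z.1 + β * z.2 q with hu
  have pu : ∀ q, PolyGrowth fun z => u z q := fun q =>
    (((polyGrowth_wishartEntry (ρ q)).comp_clm
        (ContinuousLinearMap.fst ℝ (Fin n × Fin d → ℝ) (P → ℝ))).const_mul α).add
      (((polyGrowth_apply q).comp_clm
        (ContinuousLinearMap.snd ℝ (Fin n × Fin d → ℝ) (P → ℝ))).const_mul β)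
  have pt : ∀ q, PolyGrowth fun z => f' q (u z) * σ p q := fun q =>
    ((pf' q).comp pu).mul (PolyGrowth.const _)
  rw [← integral_finsetSum _ fun q _ => (pt q).integrable _, ← integral_const_mul]
  refine integral_snd_apply_mul_eq hm hσ p (F := fun z => f (u z)) (fun z => ?_) (pf.comp pu)
    ((PolyGrowth.sum _ pt).const_mul β)
  have h1 : HasDerivAt (fun t : ℝ => u (z.1, z.2 + t • σ p)) (fun q => β * σ p q) 0 :=
    hasDerivAt_pi.2 fun q => ((hasDerivAt_add_smul_zero (z.2 q) (σ p q)).const_mul β).const_add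
      (α * wishartEntry r (ρ q) z.1)
  have h2 := (hf (u (z.1, z.2 + (0 : ℝ) • σ p))).comp_hasDerivAt (0 : ℝ) h1
  refine h2.congr_deriv ?_
  simp only [zero_smul, add_zero, sum_apply, smul_apply,
    ContinuousLinearMap.proj_apply, smul_eq_mul, Finset.mul_sum]
  exact Finset.sum_congr rfl fun q _ => by ring

end Wishart

lemma sum_Icc_one_eq_sum_fin (d : ℕ) (F : ℤ → ℝ) :
    ∑ k ∈ Finset.Icc 1 (d : ℤ), F k = ∑ k : Fin d, F ((k : ℤ) + 1) := by
  refine (Finset.sum_bij (fun (k : Fin d) _ => (k : ℤ) + 1) (fun k _ => ?_) (fun k _ l _ h => ?_)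
    (fun m hm => ?_) fun k _ => rfl).symm
  · rw [Finset.mem_Icc]
    omega
  · ext
    simpa using h
  · rw [Finset.mem_Icc] at hm
    exact ⟨⟨(m - 1).toNat, by omega⟩, Finset.mem_univ _, by simp only; omega⟩

lemma sum_abs_sub_le_tsum {r : ℤ → ℝ} (hr : Summable fun k : ℤ => |r k|) (n : ℕ) (i : ℤ) :
    ∑ a : Fin n, |r (i - a)| ≤ ∑' k : ℤ, |r k| := by
  have hinj : Set.InjOn (fun a : Fin n => i - (a : ℤ)) (Finset.univ : Finset (Fin n)) := by
    intro y _ z _ h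
    ext
    simpa using h
  rw [← Finset.sum_image (f := fun m : ℤ => |r m|) hinj]
  exact hr.sum_le_tsum _ fun m _ => abs_nonneg _

lemma sum_subtype_le_sum {α : Type*} [Fintype α] (Q : α → Prop) [DecidablePred Q] {f : α → ℝ}
    (hf : ∀ x, 0 ≤ f x) : ∑ x : {x // Q x}, f x ≤ ∑ x, f x := by
  rw [← Finset.sum_subtype (Finset.univ.filter Q) (by simp) f]
  exact Finset.sum_le_univ_sum_of_nonneg hf

section Wishart

variable {n d : ℕ} {r s : ℤ → ℝ}

lemma wishartKernel_sub_eq (hr : ∀ k, r (-k) = r k) (p q : Fin n × Fin n)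
    (x : Fin n × Fin d → ℝ) :
    wishartKernel r s p q x - (r ((p.1 : ℤ) - q.1) * r ((q.2 : ℤ) - p.2)
        + r ((p.1 : ℤ) - q.2) * r ((q.1 : ℤ) - p.2))
        * (1 / (d : ℝ) * ∑ k : Fin d, ∑ l : Fin d, s ((k : ℤ) - l) ^ 2)
      = r ((p.1 : ℤ) - q.1) * weightedFluctuation r s p.2 q.2 x
        + r ((p.1 : ℤ) - q.2) * weightedFluctuation r s p.2 q.1 x := by
  have hT : wishartKernel r s p q x = (d : ℝ)⁻¹ * ∑ k : Fin d, ∑ l : Fin d,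
      s ((k : ℤ) - l) * (r ((p.1 : ℤ) - q.1) * (x (p.2, k) * x (q.2, l))
        + r ((p.1 : ℤ) - q.2) * (x (p.2, k) * x (q.1, l))) := by
    have hd : (d : ℝ)⁻¹ = 1 / √d * (1 / √d) := by
      rw [one_div_mul_one_div, Real.mul_self_sqrt (Nat.cast_nonneg d), one_div]
    rw [wishartKernel, hd, mul_assoc]
    simp only [wishartEntryDeriv, overallCov, Finset.mul_sum]
    refine Finset.sum_congr rfl fun k _ => Finset.sum_congr rfl fun l _ => ?_
    ring
  have e1 : r ((q.2 : ℤ) - p.2) = r ((p.2 : ℤ) - q.2) := by rw [← hr, neg_sub]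
  have e2 : r ((q.1 : ℤ) - p.2) = r ((p.2 : ℤ) - q.1) := by rw [← hr, neg_sub]
  rw [hT, e1, e2]
  simp only [weightedFluctuation, overallCov, Finset.mul_sum, one_div]
  simp only [← Finset.sum_sub_distrib, ← Finset.sum_add_distrib]
  refine Finset.sum_congr rfl fun k _ => Finset.sum_congr rfl fun l _ => ?_
  ring

/-- Comparison of the shifted Wishart half-vector with a Gaussian vector of the same covariance,
on the level of laws. -/
lemma abs_integral_wishart_sub_integral_gaussian_le (hr : ∀ k, r (-k) = r k)
    (hs : ∀ k, s (-k) = s k) (hr0 : r 0 = 1) (hs0 : s 0 = 1) (hr1 : ∀ k, |r k| ≤ 1)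
    (hsum : Summable fun k : ℤ => |r k|)
    {μ : Measure (Fin n × Fin d → ℝ)} [IsGaussian μ] (hm : ∀ a, ∫ x, x a ∂μ = 0)
    (hK : ∀ a b, ∫ x, x a * x b ∂μ = overallCov n d r s a b)
    {ν : Measure ({p : Fin n × Fin n // p.1 ≤ p.2} → ℝ)} [IsGaussian ν]
    (hmν : ∀ p, ∫ y, y p ∂ν = 0)
    (hσ : ∀ p q : {p : Fin n × Fin n // p.1 ≤ p.2}, ∫ y, y p * y q ∂ν
      = (r ((p.1.1 : ℤ) - q.1.1) * r ((q.1.2 : ℤ) - p.1.2)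
        + r ((p.1.1 : ℤ) - q.1.2) * r ((q.1.1 : ℤ) - p.1.2))
        * (1 / (d : ℝ) * ∑ k : Fin d, ∑ l : Fin d, s ((k : ℤ) - l) ^ 2))
    {g : ({p : Fin n × Fin n // p.1 ≤ p.2} → ℝ) → ℝ} (hg : ContDiff ℝ 2 g)
    (hb : ∀ x p q,
      |fderiv ℝ (fun y => fderiv ℝ g y (Pi.single q 1)) x (Pi.single p 1)| ≤ 1) :
    |(∫ x, g (fun p => wishartEntry r p.1 x) ∂μ) - ∫ y, g y ∂ν|
      ≤ Real.pi * √2 * (∑' k : ℤ, |r k|) * (n : ℝ) ^ 3 / √d *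
        (∑ k ∈ Finset.Icc (-(d : ℤ)) (d : ℤ), |s k| ^ ((4 : ℝ) / 3)) ^ ((3 : ℝ) / 2) := by
  obtain ⟨pg, pg1, dg1, pg2⟩ := polyGrowth_of_second_derivatives_le hg hb
  have hg1 : ∀ p x, HasFDerivAt (fun y => fderiv ℝ g y (Pi.single p 1))
      (∑ q, fderiv ℝ (fun y => fderiv ℝ g y (Pi.single p 1)) x (Pi.single q 1) •
        (ContinuousLinearMap.proj q : ({p : Fin n × Fin n // p.1 ≤ p.2} → ℝ) →L[ℝ] ℝ)) x :=
    fun p x => by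
      rw [← fderiv_eq_sum_proj]
      exact (dg1 p x).hasFDerivAt
  have hg0 : ∀ x, HasFDerivAt g (∑ q, fderiv ℝ g x (Pi.single q 1) •
        (ContinuousLinearMap.proj q : ({p : Fin n × Fin n // p.1 ≤ p.2} → ℝ) →L[ℝ] ℝ)) x :=
    fun x => by
      rw [← fderiv_eq_sum_proj]
      exact (hg.differentiable (by norm_num) x).hasFDerivAt
  let A1 := ContinuousLinearMap.fst ℝ (Fin n × Fin d → ℝ)
    ({p : Fin n × Fin n // p.1 ≤ p.2} → ℝ)
  let A2 := ContinuousLinearMap.snd ℝ (Fin n × Fin d → ℝ)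
    ({p : Fin n × Fin n // p.1 ≤ p.2} → ℝ)
  set ρ : {p : Fin n × Fin n // p.1 ≤ p.2} → Fin n × Fin n := Subtype.val with hρ
  have main := abs_integral_sub_integral_le_of_interpolation (μ.prod ν)
    (W := fun p z => wishartEntry r (ρ p) z.1) (Y := fun p z => z.2 p)
    (T := fun p q z => wishartKernel r s (ρ p) (ρ q) z.1)
    (fun p => (polyGrowth_wishartEntry (ρ p)).comp_clm A1)
    (fun p => (polyGrowth_apply p).comp_clm A2)
    (fun p q => (polyGrowth_wishartKernel (ρ p) (ρ q)).comp_clm A1)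
    hg0 pg pg1 pg2 (fun p q x => hb x q p)
    (fun θ p => integral_wishartEntry_mul_eq ρ hs0 hm hK (hg1 p) (pg1 p) (pg2 p) _ _ (ρ p))
    (fun θ p => integral_gaussian_mul_eq ρ hmν hσ (hg1 p) (pg1 p) (pg2 p) _ _ p)
  have t1 : ∀ h : (Fin n × Fin d → ℝ) → ℝ, ∫ z, h z.1 ∂(μ.prod ν) = ∫ x, h x ∂μ := fun h => by
    simpa using integral_fun_fst (μ := μ) (ν := ν) h
  have t2 : ∫ z, g z.2 ∂(μ.prod ν) = ∫ y, g y ∂ν := by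
    simpa using integral_fun_snd (μ := μ) (ν := ν) g
  rw [t1 fun x => g fun p => wishartEntry r (ρ p) x, t2] at main
  refine main.trans ?_
  set m := √2 / √d *
    (∑ k ∈ Finset.Icc (-(d : ℤ)) (d : ℤ), |s k| ^ ((4 : ℝ) / 3)) ^ ((3 : ℝ) / 2) with hmdef
  have hS0 : 0 ≤ ∑ k ∈ Finset.Icc (-(d : ℤ)) (d : ℤ), |s k| ^ ((4 : ℝ) / 3) :=
    Finset.sum_nonneg fun k _ => by positivity
  have hm0 : 0 ≤ m := by positivity
  have hfl := integral_abs_weightedFluctuation_le hs hr0 hr1 hm hK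
  have pW := fun j b => polyGrowth_weightedFluctuation (n := n) (d := d) (r := r) (s := s) j b
  have hpq : ∀ p q : {p : Fin n × Fin n // p.1 ≤ p.2},
      ∫ z, |wishartKernel r s (ρ p) (ρ q) z.1 - (r ((p.1.1 : ℤ) - q.1.1) * r ((q.1.2 : ℤ) - p.1.2)
        + r ((p.1.1 : ℤ) - q.1.2) * r ((q.1.1 : ℤ) - p.1.2))
        * (1 / (d : ℝ) * ∑ k : Fin d, ∑ l : Fin d, s ((k : ℤ) - l) ^ 2)| ∂(μ.prod ν)
      ≤ (|r ((p.1.1 : ℤ) - q.1.1)| + |r ((p.1.1 : ℤ) - q.1.2)|) * m := fun p q => by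
    simp only [hρ, wishartKernel_sub_eq hr]
    rw [t1 fun x => |r ((p.1.1 : ℤ) - q.1.1) * weightedFluctuation r s p.1.2 q.1.2 x
        + r ((p.1.1 : ℤ) - q.1.2) * weightedFluctuation r s p.1.2 q.1.1 x|]
    have i1 := (((pW p.1.2 q.1.2).abs).const_mul |r ((p.1.1 : ℤ) - q.1.1)|).integrable μ
    have i2 := (((pW p.1.2 q.1.1).abs).const_mul |r ((p.1.1 : ℤ) - q.1.2)|).integrable μ
    have i3 := ((((pW p.1.2 q.1.2).const_mul (r ((p.1.1 : ℤ) - q.1.1))).add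
      ((pW p.1.2 q.1.1).const_mul (r ((p.1.1 : ℤ) - q.1.2)))).abs).integrable μ
    calc _ ≤ ∫ x, (|r ((p.1.1 : ℤ) - q.1.1)| * |weightedFluctuation r s p.1.2 q.1.2 x|
        + |r ((p.1.1 : ℤ) - q.1.2)| * |weightedFluctuation r s p.1.2 q.1.1 x|) ∂μ :=
          integral_mono i3 (i1.add i2) fun x =>
            (abs_add_le _ _).trans_eq (by rw [abs_mul, abs_mul])
      _ = |r ((p.1.1 : ℤ) - q.1.1)| * ∫ x, |weightedFluctuation r s p.1.2 q.1.2 x| ∂μ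
        + |r ((p.1.1 : ℤ) - q.1.2)| * ∫ x, |weightedFluctuation r s p.1.2 q.1.1 x| ∂μ := by
          rw [integral_add i1 i2, integral_const_mul, integral_const_mul]
      _ ≤ |r ((p.1.1 : ℤ) - q.1.1)| * m + |r ((p.1.1 : ℤ) - q.1.2)| * m := by
          gcongr
          · exact hfl _ _
          · exact hfl _ _
      _ = _ := by ring
  set R := ∑' k : ℤ, |r k| with hR
  have hrow : ∀ p : Fin n × Fin n, ∑ q : Fin n × Fin n,
      (|r ((p.1 : ℤ) - q.1)| + |r ((p.1 : ℤ) - q.2)|) * m ≤ 2 * n * R * m := fun p => by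
    have row := sum_abs_sub_le_tsum hsum n p.1
    have c1 : ∑ _b : Fin n, ∑ a : Fin n, |r ((p.1 : ℤ) - a)| ≤ n * R := by
      rw [Finset.sum_const, Finset.card_univ, Fintype.card_fin, nsmul_eq_mul]
      gcongr
    rw [← Finset.sum_mul, Finset.sum_add_distrib, Fintype.sum_prod_type,
      Fintype.sum_prod_type, Finset.sum_comm]
    gcongr
    linarith
  calc _ ≤ Real.pi / 2 * ∑ p : {p : Fin n × Fin n // p.1 ≤ p.2},
        ∑ q : {p : Fin n × Fin n // p.1 ≤ p.2},
          (|r ((p.1.1 : ℤ) - q.1.1)| + |r ((p.1.1 : ℤ) - q.1.2)|) * m := by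
        gcongr with p _ q _
        exact hpq p q
    _ ≤ Real.pi / 2 * ∑ p : {p : Fin n × Fin n // p.1 ≤ p.2}, ∑ q : Fin n × Fin n,
          (|r ((p.1.1 : ℤ) - q.1)| + |r ((p.1.1 : ℤ) - q.2)|) * m := by
        gcongr with p _
        exact sum_subtype_le_sum _ (f := fun q : Fin n × Fin n =>
          (|r ((p.1.1 : ℤ) - q.1)| + |r ((p.1.1 : ℤ) - q.2)|) * m) fun q => by positivity
    _ ≤ Real.pi / 2 * ∑ p : Fin n × Fin n, ∑ q : Fin n × Fin n,
          (|r ((p.1 : ℤ) - q.1)| + |r ((p.1 : ℤ) - q.2)|) * m := by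
        gcongr
        exact sum_subtype_le_sum _ (f := fun p : Fin n × Fin n => ∑ q : Fin n × Fin n,
          (|r ((p.1 : ℤ) - q.1)| + |r ((p.1 : ℤ) - q.2)|) * m) fun p => by positivity
    _ ≤ Real.pi / 2 * ∑ _p : Fin n × Fin n, 2 * n * R * m := by
        gcongr with p _
        exact hrow p
    _ = _ := by
        simp only [Finset.sum_const, Finset.card_univ, Fintype.card_prod, Fintype.card_fin,
          nsmul_eq_mul, Nat.cast_mul, hmdef]
        ring

end Wishart

/-- **Theorem 4.2, part (3)**: `d₂` bound between the half-vector of the shifted Wishart matrix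
with overall correlation `(r, s)` and the Gaussian vector with the same covariance, with rate
`C ‖r‖_{ℓ¹} n³ d^{-1/2} (∑_{|k|≤d} |s(k)|^{4/3})^{3/2}` when `r ∈ ℓ¹(ℤ)`. -/
theorem shifted_wishart_d2_bound_summable_correlation :
    ∃ C > (0 : ℝ), ∀ (n d : ℕ), 1 ≤ n → 1 ≤ d →
      ∀ (r s : ℤ → ℝ), (∀ k, r (-k) = r k) → (∀ k, s (-k) = s k) →
      r 0 = 1 → s 0 = 1 → (∀ k, |r k| ≤ 1) → Summable (fun k : ℤ => s k ^ 2) →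
      Summable (fun k : ℤ => |r k|) →
      ∀ (Ω : Type) [MeasureSpace Ω], IsProbabilityMeasure (volume : Measure Ω) →
      ∀ X : Fin n → Fin d → Ω → ℝ,
        IsCenteredGaussianFamily (fun p : Fin n × Fin d => X p.1 p.2) →
        (∀ (i j : Fin n) (k l : Fin d),
          ∫ ω, X i k ω * X j l ω = r ((i : ℤ) - (j : ℤ)) * s ((k : ℤ) - (l : ℤ))) →
      ∀ Wt : Fin n → Fin n → Ω → ℝ,
        (∀ i j ω, Wt i j ω =
          (1 / Real.sqrt d) * ∑ k : Fin d, (X i k ω * X j k ω - r ((i : ℤ) - (j : ℤ)))) →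
      ∀ G : {p : Fin n × Fin n // p.1 ≤ p.2} → Ω → ℝ,
        IsCenteredGaussianFamily G →
        (∀ (i j u v : Fin n) (hij : i ≤ j) (huv : u ≤ v),
          ∫ ω, G ⟨(i, j), hij⟩ ω * G ⟨(u, v), huv⟩ ω =
            (r ((i : ℤ) - (u : ℤ)) * r ((v : ℤ) - (j : ℤ))
              + r ((i : ℤ) - (v : ℤ)) * r ((u : ℤ) - (j : ℤ)))
              * ((1 / (d : ℝ)) * ∑ k ∈ Finset.Icc 1 (d : ℤ), ∑ l ∈ Finset.Icc 1 (d : ℤ),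
                  s (k - l) ^ 2)) →
      ∀ g : ({p : Fin n × Fin n // p.1 ≤ p.2} → ℝ) → ℝ, ContDiff ℝ 2 g →
        (∀ (x : {p : Fin n × Fin n // p.1 ≤ p.2} → ℝ) (p q : {p : Fin n × Fin n // p.1 ≤ p.2}),
          |fderiv ℝ (fun y => fderiv ℝ g y (Pi.single q 1)) x (Pi.single p 1)| ≤ 1) →
      |(∫ ω, g (fun p => Wt p.1.1 p.1.2 ω)) - ∫ ω, g (fun p => G p ω)| ≤
        C * (∑' k : ℤ, |r k|) * (n : ℝ) ^ 3 / Real.sqrt d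
          * (∑ k ∈ Finset.Icc (-(d : ℤ)) (d : ℤ), |s k| ^ ((4 : ℝ) / 3)) ^ ((3 : ℝ) / 2) := by
  refine ⟨Real.pi * √2, by positivity, ?_⟩
  intro n d _ _ r s hr hs hr0 hs0 hr1 _ hsum Ω _ _ X hX hXcov Wt hWt G hG hGcov g hg hb
  obtain ⟨mX, gX, zX⟩ := hX.isGaussian_map
  obtain ⟨mG, gG, zG⟩ := hG.isGaussian_map
  have hK : ∀ a b, ∫ x, x a * x b ∂(volume.map fun ω (i : Fin n × Fin d) => X i.1 i.2 ω)
      = overallCov n d r s a b := fun a b => by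
    rw [integral_map mX
      ((polyGrowth_apply a).mul (polyGrowth_apply b)).1.aestronglyMeasurable]
    exact hXcov a.1 b.1 a.2 b.2
  have hσ : ∀ p q : {p : Fin n × Fin n // p.1 ≤ p.2},
      ∫ y, y p * y q ∂(volume.map fun ω i => G i ω)
      = (r ((p.1.1 : ℤ) - q.1.1) * r ((q.1.2 : ℤ) - p.1.2)
        + r ((p.1.1 : ℤ) - q.1.2) * r ((q.1.1 : ℤ) - p.1.2))
        * (1 / (d : ℝ) * ∑ k : Fin d, ∑ l : Fin d, s ((k : ℤ) - l) ^ 2) := fun p q => by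
    rw [integral_map mG
      ((polyGrowth_apply p).mul (polyGrowth_apply q)).1.aestronglyMeasurable]
    refine (hGcov p.1.1 p.1.2 q.1.1 q.1.2 p.2 q.2).trans ?_
    simp only [sum_Icc_one_eq_sum_fin, add_sub_add_right_eq_sub]
  have key := abs_integral_wishart_sub_integral_gaussian_le hr hs hr0 hs0 hr1 hsum zX hK zG hσ hg
    fun x p q => hb x p q
  have cW : Continuous fun x : Fin n × Fin d → ℝ =>
      g fun p => wishartEntry r p.1 x :=
    hg.continuous.comp (continuous_pi fun p => (polyGrowth_wishartEntry p.1).1)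
  rw [integral_map mX cW.aestronglyMeasurable,
    integral_map mG hg.continuous.aestronglyMeasurable] at key
  simpa only [hWt, wishartEntry] using key
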